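/- arXiv:2105.05232 — 5 statements merged into one kernel-verified Lean document; each statement's English description precedes it below -/
import Mathlib

section
/- Second-moment Weingarten formula for the unitary group: for every d ≥ 2 and all indices i₁, i₂, i₃, i₄, j₁, j₂, j₃, j₄ ∈ {1,…,d}, with U drawn from the Haar probability measure on U(d), ∫ U_{i₁j₁} U_{i₂j₂} conj(U_{i₃j₃}) conj(U_{i₄j₄}) dμ(U) = (δ_{i₁i₃}δ_{i₂i₄}δ_{j₁j₃}δ_{j₂j₄} + δ_{i₁i₄}δ_{i₂i₃}δ_{j₁j₄}δ_{j₂j₃})/(d²−1) − (δ_{i₁i₃}δ_{i₂i₄}δ_{j₁j₄}δ_{j₂j₃} + δ_{i₁i₄}δ_{i₂i₃}δ_{j₁j₃}δ_{j₂j₄})/(d(d²−1)). In particular, for d = 4 the two coefficients are 1/15 and −1/60, which are the weights of the classical spin model onto which random quantum circuits are mapped. -/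
open MeasureTheory Matrix

noncomputable section

/-- Measurable structure on complex matrices (Borel of the product topology). -/
instance matMS (m n : Type*) [Fintype m] [Fintype n] : MeasurableSpace (Matrix m n ℂ) :=
  borel _

instance matBS (m n : Type*) [Fintype m] [Fintype n] : BorelSpace (Matrix m n ℂ) := ⟨rfl⟩

/-- Kronecker delta with values in `ℂ`. -/
def kdelta {d : ℕ} (i j : Fin d) : ℂ := if i = j then 1 else 0

namespace Weingarten

variable {d : ℕ}

/-- The mixed second moment `∫ U_{a j₁} U_{b j₂} conj(U_{c j₃}) conj(U_{e j₄}) dμ`. -/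
def moment (μ : Measure (Matrix.unitaryGroup (Fin d) ℂ)) (j₁ j₂ j₃ j₄ a b c e : Fin d) : ℂ :=
  ∫ U : Matrix.unitaryGroup (Fin d) ℂ,
    (U : Matrix (Fin d) (Fin d) ℂ) a j₁ * (U : Matrix (Fin d) (Fin d) ℂ) b j₂ *
      (starRingEnd ℂ) ((U : Matrix (Fin d) (Fin d) ℂ) c j₃) *
      (starRingEnd ℂ) ((U : Matrix (Fin d) (Fin d) ℂ) e j₄) ∂μ

lemma continuous_entry (a j : Fin d) :
    Continuous fun U : Matrix.unitaryGroup (Fin d) ℂ => (U : Matrix (Fin d) (Fin d) ℂ) a j :=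
  continuous_subtype_val.matrix_elem a j

lemma integrable_moment (μ : Measure (Matrix.unitaryGroup (Fin d) ℂ)) [IsFiniteMeasure μ]
    (j₁ j₂ j₃ j₄ a b c e : Fin d) :
    Integrable (fun U : Matrix.unitaryGroup (Fin d) ℂ =>
      (U : Matrix (Fin d) (Fin d) ℂ) a j₁ * (U : Matrix (Fin d) (Fin d) ℂ) b j₂ *
        (starRingEnd ℂ) ((U : Matrix (Fin d) (Fin d) ℂ) c j₃) *
        (starRingEnd ℂ) ((U : Matrix (Fin d) (Fin d) ℂ) e j₄)) μ := by
  have hcont := ((((continuous_entry a j₁).mul (continuous_entry b j₂)).mul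
    (Complex.continuous_conj.comp (continuous_entry c j₃))).mul
    (Complex.continuous_conj.comp (continuous_entry e j₄)))
  refine Integrable.of_bound hcont.aestronglyMeasurable 1 (Filter.Eventually.of_forall fun U => ?_)
  have h := fun i j => entry_norm_bound_of_unitary U.2 i j
  simp only [norm_mul, RCLike.norm_conj]
  exact mul_le_one₀ (mul_le_one₀ (mul_le_one₀ (h _ _) (norm_nonneg _) (h _ _))
    (norm_nonneg _) (h _ _)) (norm_nonneg _) (h _ _)

section Invariance

variable (μ : Measure (Matrix.unitaryGroup (Fin d) ℂ)) [IsFiniteMeasure μ]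
  [μ.IsMulLeftInvariant] (j₁ j₂ j₃ j₄ : Fin d)

/-- Left invariance of `μ`, written out in matrix entries. -/
lemma moment_eq_sum (V : Matrix (Fin d) (Fin d) ℂ) (hV : V ∈ Matrix.unitaryGroup (Fin d) ℂ)
    (a b c e : Fin d) :
    moment μ j₁ j₂ j₃ j₄ a b c e =
      ∑ k₁, ∑ k₂, ∑ k₃, ∑ k₄, V a k₁ * V b k₂ * (starRingEnd ℂ) (V c k₃) *
        (starRingEnd ℂ) (V e k₄) * moment μ j₁ j₂ j₃ j₄ k₁ k₂ k₃ k₄ := by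
  have hint := fun k₁ k₂ k₃ k₄ =>
    (integrable_moment μ j₁ j₂ j₃ j₄ k₁ k₂ k₃ k₄).const_mul
      (V a k₁ * V b k₂ * (starRingEnd ℂ) (V c k₃) * (starRingEnd ℂ) (V e k₄))
  simp only [moment, ← integral_const_mul]
  rw [← integral_mul_left_eq_self _ (⟨V, hV⟩ : Matrix.unitaryGroup (Fin d) ℂ)]
  simp_rw [← integral_finsetSum _ fun k₄ _ => hint _ _ _ k₄]
  simp_rw [← integral_finsetSum _ fun k₃ _ => integrable_finsetSum _ fun k₄ _ => hint _ _ k₃ k₄]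
  simp_rw [← integral_finsetSum _ fun k₂ _ => integrable_finsetSum _ fun k₃ _ =>
    integrable_finsetSum _ fun k₄ _ => hint _ k₂ k₃ k₄]
  rw [← integral_finsetSum _ fun k₁ _ => integrable_finsetSum _ fun k₂ _ =>
    integrable_finsetSum _ fun k₃ _ => integrable_finsetSum _ fun k₄ _ => hint k₁ k₂ k₃ k₄]
  refine integral_congr_ae (Filter.Eventually.of_forall fun U => ?_)
  simp only [Submonoid.coe_mul, Matrix.mul_apply, map_sum, map_mul]
  have hprod (f g h k : Fin d → ℂ) : (∑ i, f i) * (∑ i, g i) * (∑ i, h i) * (∑ i, k i) =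
      ∑ k₁, ∑ k₂, ∑ k₃, ∑ k₄, f k₁ * g k₂ * h k₃ * k k₄ := by
    simp only [mul_assoc, ← Finset.mul_sum, ← Finset.sum_mul]
  rw [hprod]
  refine Finset.sum_congr rfl fun _ _ => Finset.sum_congr rfl fun _ _ =>
    Finset.sum_congr rfl fun _ _ => Finset.sum_congr rfl fun _ _ => ?_
  ring

lemma moment_diagonal (z : Fin d → ℂ) (hz : ∀ i, z i * (starRingEnd ℂ) (z i) = 1)
    (a b c e : Fin d) :
    moment μ j₁ j₂ j₃ j₄ a b c e =
      z a * z b * (starRingEnd ℂ) (z c) * (starRingEnd ℂ) (z e) *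
        moment μ j₁ j₂ j₃ j₄ a b c e := by
  have hV : Matrix.diagonal z ∈ Matrix.unitaryGroup (Fin d) ℂ := by
    rw [Matrix.mem_unitaryGroup_iff, Matrix.star_eq_conjTranspose, Matrix.diagonal_conjTranspose,
      Matrix.diagonal_mul_diagonal, ← Matrix.diagonal_one]
    exact congrArg _ (funext hz)
  conv_lhs => rw [moment_eq_sum μ j₁ j₂ j₃ j₄ _ hV]
  simp [Matrix.diagonal_apply, apply_ite (starRingEnd ℂ), ite_mul, mul_ite]

lemma moment_perm (σ : Equiv.Perm (Fin d)) (a b c e : Fin d) :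
    moment μ j₁ j₂ j₃ j₄ (σ a) (σ b) (σ c) (σ e) = moment μ j₁ j₂ j₃ j₄ a b c e := by
  have hV : σ.permMatrix ℂ ∈ Matrix.unitaryGroup (Fin d) ℂ := by
    rw [Matrix.mem_unitaryGroup_iff, Matrix.star_eq_conjTranspose, Matrix.conjTranspose_permMatrix,
      ← Matrix.permMatrix_mul]
    simp
  rw [moment_eq_sum μ j₁ j₂ j₃ j₄ _ hV a b c e]
  simp [Equiv.Perm.permMatrix, PEquiv.toMatrix_apply, apply_ite (starRingEnd ℂ)]

lemma moment_eq_zero (a b c e : Fin d) (h₁ : ¬ (a = c ∧ b = e)) (h₂ : ¬ (a = e ∧ b = c)) :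
    moment μ j₁ j₂ j₃ j₄ a b c e = 0 := by
  have key (p : Fin d) := moment_diagonal μ j₁ j₂ j₃ j₄ (fun i => if i = p then Complex.I else 1)
    (fun i => by split_ifs <;> simp) a b c e
  have ha := key a
  have hb := key b
  by_contra hm
  have ha' := mul_right_cancel₀ hm ((one_mul _).trans ha)
  have hb' := mul_right_cancel₀ hm ((one_mul _).trans hb)
  clear key ha hb
  simp only [apply_ite (starRingEnd ℂ), Complex.conj_I, map_one] at ha' hb'
  split_ifs at ha' hb' <;> simp [Complex.ext_iff] at ha' hb' <;> grind

/-- Averaging over the unitary `(1 + i σ)/√2`, where `σ` swaps `p` and `q`. -/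
lemma moment_self {p q : Fin d} (hpq : p ≠ q) :
    moment μ j₁ j₂ j₃ j₄ p p p p =
      moment μ j₁ j₂ j₃ j₄ p q p q + moment μ j₁ j₂ j₃ j₄ p q q p := by
  set S : Matrix (Fin d) (Fin d) ℂ := (Equiv.swap p q).permMatrix ℂ with hS
  have hSS : S * S = 1 := by
    rw [hS, ← Matrix.permMatrix_mul]; simp
  have hSH : Sᴴ = S := by
    rw [hS, Matrix.conjTranspose_permMatrix]; simp
  set r : ℂ := ((√2 : ℝ) : ℂ)⁻¹ with hr
  have hrr : r * r = 1 / 2 := by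
    rw [hr, ← mul_inv, ← Complex.ofReal_mul, Real.mul_self_sqrt (by norm_num)]; simp
  have hrc : (starRingEnd ℂ) r = r := by simp [hr]
  have hV : r • (1 + Complex.I • S) ∈ Matrix.unitaryGroup (Fin d) ℂ := by
    rw [Matrix.mem_unitaryGroup_iff, Matrix.star_eq_conjTranspose]
    simp only [Matrix.conjTranspose_smul, Matrix.conjTranspose_add, hSH,
      Matrix.conjTranspose_one, Complex.star_def, hrc, Complex.conj_I, smul_mul_smul_comm, hrr,
      mul_add, add_mul, one_mul, mul_one, hSS,
      Complex.I_mul_I, mul_neg]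
    module
  have hrow (k : Fin d) : (r • (1 + Complex.I • S)) p k =
      r * ((if p = k then 1 else 0) + Complex.I * (if q = k then 1 else 0)) := by
    simp [hS, Equiv.Perm.permMatrix, PEquiv.toMatrix_apply, Matrix.one_apply]
  have hsum := moment_eq_sum μ j₁ j₂ j₃ j₄ _ hV p p p p
  have hswap := moment_perm μ j₁ j₂ j₃ j₄ (Equiv.swap p q)
  have h1 := hswap p p p p
  have h2 := hswap p q p q
  have h3 := hswap p q q p
  simp only [Equiv.swap_apply_left, Equiv.swap_apply_right] at h1 h2 h3
  have hz := moment_eq_zero μ j₁ j₂ j₃ j₄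
  simp only [hrow, map_mul, map_add, apply_ite (starRingEnd ℂ), map_one, map_zero, hrc,
    Complex.conj_I] at hsum
  simp [mul_add, add_mul, Finset.sum_add_distrib, hz, h1, h2, h3, hpq, hpq.symm] at hsum
  have hr4 : r ^ 4 = 1 / 4 := by linear_combination (r * r + 1 / 2) * hrr
  ring_nf at hsum
  simp only [Complex.I_sq, Complex.I_pow_four, hr4] at hsum
  linear_combination 2 * hsum

/-- Every left-invariant second moment is a combination of the two permutation tensors. -/
lemma moment_eq_kdelta {p q : Fin d} (hpq : p ≠ q) (a b c e : Fin d) :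
    moment μ j₁ j₂ j₃ j₄ a b c e =
      moment μ j₁ j₂ j₃ j₄ p q p q * (kdelta a c * kdelta b e) +
        moment μ j₁ j₂ j₃ j₄ p q q p * (kdelta a e * kdelta b c) := by
  have hσ {a b : Fin d} (hab : a ≠ b) : ∃ σ : Equiv.Perm (Fin d), σ p = a ∧ σ q = b := by
    refine ⟨Equiv.swap (Equiv.swap p a q) b * Equiv.swap p a, ?_, by simp⟩
    have : a ≠ Equiv.swap p a q := fun h =>
      hpq ((Equiv.swap p a).injective ((Equiv.swap_apply_left p a).trans h))
    simp [Equiv.swap_apply_of_ne_of_ne this hab]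
  by_cases h : (a = c ∧ b = e) ∨ (a = e ∧ b = c)
  · by_cases hab : a = b
    · obtain ⟨rfl, rfl, rfl⟩ : b = a ∧ c = a ∧ e = a := by grind
      have h1 := moment_perm μ j₁ j₂ j₃ j₄ (Equiv.swap p e) p p p p
      rw [Equiv.swap_apply_left] at h1
      simp [kdelta, h1, moment_self μ j₁ j₂ j₃ j₄ hpq]
    · obtain ⟨σ, rfl, rfl⟩ := hσ hab
      rcases h with ⟨rfl, rfl⟩ | ⟨rfl, rfl⟩ <;>
        simp [kdelta, moment_perm, hpq, hpq.symm]
  · push Not at h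
    rw [moment_eq_zero μ j₁ j₂ j₃ j₄ a b c e (by grind) (by grind)]
    simp only [kdelta]
    grind

end Invariance

lemma sum_entry_mul_conj (U : Matrix.unitaryGroup (Fin d) ℂ) (j k : Fin d) :
    ∑ a, (U : Matrix (Fin d) (Fin d) ℂ) a j *
      (starRingEnd ℂ) ((U : Matrix (Fin d) (Fin d) ℂ) a k) = kdelta j k := by
  have h := congrFun (congrFun (Matrix.mem_unitaryGroup_iff'.1 U.2) k) j
  simp only [Matrix.mul_apply, Matrix.star_apply, Matrix.one_apply] at h
  rw [kdelta, ← ite_congr (propext eq_comm) (fun _ => rfl) (fun _ => rfl), ← h]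
  exact Finset.sum_congr rfl fun _ _ => mul_comm _ _

variable (μ : Measure (Matrix.unitaryGroup (Fin d) ℂ)) [IsProbabilityMeasure μ]
  (j₁ j₂ j₃ j₄ : Fin d)

lemma sum_moment_direct :
    ∑ a, ∑ b, moment μ j₁ j₂ j₃ j₄ a b a b = kdelta j₁ j₃ * kdelta j₂ j₄ := by
  have hint := fun a b => integrable_moment μ j₁ j₂ j₃ j₄ a b a b
  simp only [moment]
  simp_rw [← integral_finsetSum _ fun b _ => hint _ b]
  rw [← integral_finsetSum _ fun a _ => integrable_finsetSum _ fun b _ => hint a b]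
  rw [integral_congr_ae (g := fun _ => kdelta j₁ j₃ * kdelta j₂ j₄)
    (Filter.Eventually.of_forall fun U => ?_)]
  · simp
  · simp only [← sum_entry_mul_conj U, Finset.sum_mul_sum]
    exact Finset.sum_congr rfl fun _ _ => Finset.sum_congr rfl fun _ _ => by ring

lemma sum_moment_crossed :
    ∑ a, ∑ b, moment μ j₁ j₂ j₃ j₄ a b b a = kdelta j₁ j₄ * kdelta j₂ j₃ := by
  rw [← sum_moment_direct μ j₁ j₂ j₄ j₃]
  simp only [moment]
  refine Finset.sum_congr rfl fun a _ => Finset.sum_congr rfl fun b _ => ?_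
  exact integral_congr_ae (Filter.Eventually.of_forall fun U => mul_right_comm _ _ _)

end Weingarten

/-- **Second-moment Weingarten formula for the unitary group.**
For every `d ≥ 2`, all matrix indices, and `U` drawn from the Haar probability measure `μ`
on `U(d)`:
`∫ U_{i₁j₁} U_{i₂j₂} conj(U_{i₃j₃}) conj(U_{i₄j₄}) dμ`
`= (δ_{i₁i₃}δ_{i₂i₄}δ_{j₁j₃}δ_{j₂j₄} + δ_{i₁i₄}δ_{i₂i₃}δ_{j₁j₄}δ_{j₂j₃})/(d²−1)`
`− (δ_{i₁i₃}δ_{i₂i₄}δ_{j₁j₄}δ_{j₂j₃} + δ_{i₁i₄}δ_{i₂i₃}δ_{j₁j₃}δ_{j₂j₄})/(d(d²−1))`. -/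
theorem weingarten_second_moment
    (d : ℕ) (hd : 2 ≤ d)
    (μ : Measure (Matrix.unitaryGroup (Fin d) ℂ)) [μ.IsHaarMeasure]
    [IsProbabilityMeasure μ]
    (i₁ i₂ i₃ i₄ j₁ j₂ j₃ j₄ : Fin d) :
    (∫ U : Matrix.unitaryGroup (Fin d) ℂ,
        (U : Matrix (Fin d) (Fin d) ℂ) i₁ j₁ * (U : Matrix (Fin d) (Fin d) ℂ) i₂ j₂ *
          (starRingEnd ℂ) ((U : Matrix (Fin d) (Fin d) ℂ) i₃ j₃) *
          (starRingEnd ℂ) ((U : Matrix (Fin d) (Fin d) ℂ) i₄ j₄) ∂μ)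
      = (kdelta i₁ i₃ * kdelta i₂ i₄ * kdelta j₁ j₃ * kdelta j₂ j₄ +
            kdelta i₁ i₄ * kdelta i₂ i₃ * kdelta j₁ j₄ * kdelta j₂ j₃) / ((d : ℂ) ^ 2 - 1)
        - (kdelta i₁ i₃ * kdelta i₂ i₄ * kdelta j₁ j₄ * kdelta j₂ j₃ +
            kdelta i₁ i₄ * kdelta i₂ i₃ * kdelta j₁ j₃ * kdelta j₂ j₄) /
          ((d : ℂ) * ((d : ℂ) ^ 2 - 1)) := by
  have hpq : (⟨0, by omega⟩ : Fin d) ≠ ⟨1, by omega⟩ := by simp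
  obtain ⟨A, B, key⟩ : ∃ A B, ∀ a b c e, Weingarten.moment μ j₁ j₂ j₃ j₄ a b c e =
      A * (kdelta a c * kdelta b e) + B * (kdelta a e * kdelta b c) :=
    ⟨_, _, Weingarten.moment_eq_kdelta μ j₁ j₂ j₃ j₄ hpq⟩
  have hA := Weingarten.sum_moment_direct μ j₁ j₂ j₃ j₄
  have hB := Weingarten.sum_moment_crossed μ j₁ j₂ j₃ j₄
  change Weingarten.moment μ j₁ j₂ j₃ j₄ i₁ i₂ i₃ i₄ = _
  simp only [key] at hA hB ⊢
  have hd₀ : (d : ℂ) ≠ 0 := by norm_cast; omega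
  have hd₁ : (d : ℂ) ^ 2 - 1 ≠ 0 := by
    rw [sub_ne_zero]
    norm_cast
    nlinarith
  have h₁ (a : Fin d) : kdelta a a = 1 := if_pos rfl
  have h₂ : ∑ a : Fin d, ∑ b : Fin d, kdelta a b * kdelta b a = (d : ℂ) := by
    simp [kdelta]
  simp only [Finset.sum_add_distrib, ← Finset.mul_sum, h₁, h₂, Finset.sum_const, Finset.card_univ,
    Fintype.card_fin, nsmul_eq_mul, mul_one] at hA hB
  have hA' : A = (kdelta j₁ j₃ * kdelta j₂ j₄) / ((d : ℂ) ^ 2 - 1) -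
      (kdelta j₁ j₄ * kdelta j₂ j₃) / ((d : ℂ) * ((d : ℂ) ^ 2 - 1)) := by
    rw [← hA, ← hB]; field_simp; ring
  have hB' : B = (kdelta j₁ j₄ * kdelta j₂ j₃) / ((d : ℂ) ^ 2 - 1) -
      (kdelta j₁ j₃ * kdelta j₂ j₄) / ((d : ℂ) * ((d : ℂ) ^ 2 - 1)) := by
    rw [← hA, ← hB]; field_simp; ring
  rw [hA', hB']
  ring

end
end

section
/- For every d ≥ 1 and every matrix A ∈ M_d(ℂ), with U drawn from the Haar probability measure on U(d), ∫_{U(d)} |⟨e₀| U† A U |e₀⟩|² dμ(U) = (|Tr A|² + Tr(A A†)) / (d(d+1)). In particular, if A is traceless with Tr(A A†) = d (for example a nonidentity n-qubit Pauli string with d = 2^n, or X ⊗ I with d = 4), this expectation equals 1/(d+1); for d = 4 and A = X ⊗ I it equals 1/5. -/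
open MeasureTheory Matrix

noncomputable section

namespace Matrix.UnitaryGroup

variable {n : Type*} [Fintype n] [DecidableEq n]

instance compactSpace : CompactSpace (unitaryGroup n ℂ) := by
  refine isCompact_iff_compactSpace.mp (IsCompact.of_isClosed_subset
    (isCompact_univ_pi fun _ => isCompact_univ_pi fun _ => isCompact_closedBall (0 : ℂ) 1)
    (isClosed_unitary (R := Matrix n n ℂ)) fun U hU i _ j _ => ?_)
  simpa using entry_norm_bound_of_unitary hU i j

theorem integrable_of_continuous {μ : Measure (unitaryGroup n ℂ)} [IsFiniteMeasure μ]
    {F : unitaryGroup n ℂ → ℝ} (hF : Continuous F) : Integrable F μ :=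
  hF.integrable_of_hasCompactSupport (HasCompactSupport.of_compactSpace F)

theorem continuous_entry (i k : n) :
    Continuous fun U : unitaryGroup n ℂ => (U : Matrix n n ℂ) i k :=
  continuous_subtype_val.matrix_elem i k

theorem continuous_normSq_entry (i k : n) :
    Continuous fun U : unitaryGroup n ℂ => Complex.normSq ((U : Matrix n n ℂ) i k) :=
  Complex.continuous_normSq.comp (continuous_entry i k)

theorem sum_normSq_col (U : unitaryGroup n ℂ) (k : n) :
    ∑ i, Complex.normSq ((U : Matrix n n ℂ) i k) = 1 := by
  have h := congrFun (congrFun (UnitaryGroup.star_mul_self U) k) k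
  rw [star_eq_conjTranspose, Matrix.mul_apply, one_apply_eq] at h
  simp only [conjTranspose_apply, Complex.star_def, ← Complex.normSq_eq_conj_mul_self] at h
  exact_mod_cast h

variable (μ : Measure (unitaryGroup n ℂ)) [μ.IsMulLeftInvariant]

theorem integral_mulVec_col (V : unitaryGroup n ℂ) (k : n) (F : (n → ℂ) → ℝ) :
    ∫ U : unitaryGroup n ℂ, F ((V : Matrix n n ℂ) *ᵥ (U : Matrix n n ℂ).col k) ∂μ =
      ∫ U : unitaryGroup n ℂ, F ((U : Matrix n n ℂ).col k) ∂μ :=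
  integral_mul_left_eq_self
    (fun U : unitaryGroup n ℂ => F ((U : Matrix n n ℂ).col k)) V

theorem permMatrix_mem (σ : Equiv.Perm n) : σ.permMatrix ℂ ∈ unitaryGroup n ℂ := by
  rw [mem_unitaryGroup_iff, star_eq_conjTranspose, conjTranspose_permMatrix, ← permMatrix_mul,
    inv_mul_cancel, permMatrix_one]

theorem diagonal_mem {c : n → ℂ} (hc : ∀ i, Complex.normSq (c i) = 1) :
    diagonal c ∈ unitaryGroup n ℂ := by
  rw [mem_unitaryGroup_iff, star_eq_conjTranspose, diagonal_conjTranspose, diagonal_mul_diagonal,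
    ← diagonal_one]
  congr 1
  funext i
  simp [Complex.mul_conj, hc]

theorem swap_mix_mem (i j : n) :
    ((1 + Complex.I) / 2) • (1 : Matrix n n ℂ) +
      ((1 - Complex.I) / 2) • (Equiv.swap i j).permMatrix ℂ ∈ unitaryGroup n ℂ := by
  have hS : (Equiv.swap i j).permMatrix ℂ * (Equiv.swap i j).permMatrix ℂ = 1 := by
    rw [← permMatrix_mul, Equiv.swap_mul_self, permMatrix_one]
  rw [mem_unitaryGroup_iff, star_eq_conjTranspose, conjTranspose_add, conjTranspose_smul,
    conjTranspose_smul, conjTranspose_one, conjTranspose_permMatrix, Equiv.swap_inv]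
  simp only [add_mul, mul_add, smul_mul_smul_comm, hS, one_mul, mul_one, Complex.star_def,
    map_div₀, map_add, map_sub, map_one, Complex.conj_I, map_ofNat]
  match_scalars <;> ring_nf <;> norm_num [Complex.I_sq]

theorem integral_normSq_sq_eq (i j k : n) :
    ∫ U : unitaryGroup n ℂ, Complex.normSq ((U : Matrix n n ℂ) i k) ^ 2 ∂μ =
      ∫ U : unitaryGroup n ℂ, Complex.normSq ((U : Matrix n n ℂ) j k) ^ 2 ∂μ := by
  have h := integral_mulVec_col μ ⟨_, permMatrix_mem (Equiv.swap i j)⟩ k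
    fun v => Complex.normSq (v j) ^ 2
  simpa [permMatrix_mulVec] using h

theorem integral_normSq_add_mul_sq {i j : n} (hij : i ≠ j) (k : n) {z : ℂ}
    (hz : Complex.normSq z = 1) :
    ∫ U : unitaryGroup n ℂ, Complex.normSq
        ((U : Matrix n n ℂ) i k + z * (U : Matrix n n ℂ) j k) ^ 2 ∂μ =
      4 * ∫ U : unitaryGroup n ℂ, Complex.normSq ((U : Matrix n n ℂ) i k) ^ 2 ∂μ := by
  have hW := integral_mulVec_col μ ⟨_, swap_mix_mem i j⟩ k fun v => Complex.normSq (v i) ^ 2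
  have hD := integral_mulVec_col μ ⟨_, diagonal_mem (c := Function.update 1 j (Complex.I * z))
    (fun l => by by_cases h : l = j <;> simp [h, hz])⟩ k
    fun v => Complex.normSq (v i - Complex.I * v j) ^ 2
  have hD' (U : unitaryGroup n ℂ) : Complex.normSq
      ((U : Matrix n n ℂ) i k + z * (U : Matrix n n ℂ) j k) ^ 2 = Complex.normSq
      ((diagonal (Function.update 1 j (Complex.I * z)) *ᵥ (U : Matrix n n ℂ).col k) i -
        Complex.I * (diagonal (Function.update 1 j (Complex.I * z)) *ᵥ
          (U : Matrix n n ℂ).col k) j) ^ 2 := by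
    have hI : Complex.I * (Complex.I * z * (U : Matrix n n ℂ) j k) =
        -(z * (U : Matrix n n ℂ) j k) := by
      linear_combination (z * (U : Matrix n n ℂ) j k) * Complex.I_mul_I
    simp [mulVec_diagonal, hij, hI]
  have hW' (U : unitaryGroup n ℂ) : Complex.normSq
      (((U : Matrix n n ℂ).col k) i - Complex.I * ((U : Matrix n n ℂ).col k) j) ^ 2 =
      4 * Complex.normSq (((((1 + Complex.I) / 2) • (1 : Matrix n n ℂ) +
        ((1 - Complex.I) / 2) • (Equiv.swap i j).permMatrix ℂ) *ᵥ
          (U : Matrix n n ℂ).col k) i) ^ 2 := by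
    simp only [add_mulVec, smul_mulVec, one_mulVec, permMatrix_mulVec, Pi.add_apply,
      Pi.smul_apply, Function.comp_apply, Equiv.swap_apply_left, smul_eq_mul, Complex.normSq_apply]
    simp
    ring
  simp_rw [hD']
  rw [hD]
  simp_rw [hW']
  rw [integral_const_mul, hW]
  rfl

theorem sum_normSq_add_mul_sq (x y : ℂ) :
    Complex.normSq (x + 1 * y) ^ 2 + Complex.normSq (x + -1 * y) ^ 2 +
      Complex.normSq (x + Complex.I * y) ^ 2 + Complex.normSq (x + -Complex.I * y) ^ 2 =
    4 * Complex.normSq x ^ 2 + 4 * Complex.normSq y ^ 2 +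
      16 * (Complex.normSq x * Complex.normSq y) := by
  simp [Complex.normSq_apply]
  ring

variable [IsProbabilityMeasure μ]

theorem integral_normSq_sq_eq_two_mul {i j : n} (hij : i ≠ j) (k : n) :
    ∫ U : unitaryGroup n ℂ, Complex.normSq ((U : Matrix n n ℂ) i k) ^ 2 ∂μ =
      2 * ∫ U : unitaryGroup n ℂ, Complex.normSq ((U : Matrix n n ℂ) i k) *
        Complex.normSq ((U : Matrix n n ℂ) j k) ∂μ := by
  have hi := continuous_entry (n := n) i k
  have hj := continuous_entry (n := n) j k
  have hc (z : ℂ) : Continuous fun U : unitaryGroup n ℂ => Complex.normSq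
      ((U : Matrix n n ℂ) i k + z * (U : Matrix n n ℂ) j k) :=
    Complex.continuous_normSq.comp (hi.add (continuous_const.mul hj))
  have hi := continuous_normSq_entry (n := n) i k
  have hj := continuous_normSq_entry (n := n) j k
  have h := congrArg (fun F : unitaryGroup n ℂ → ℝ => ∫ U, F U ∂μ) (funext fun U =>
    sum_normSq_add_mul_sq ((U : Matrix n n ℂ) i k) ((U : Matrix n n ℂ) j k))
  rw [integral_add, integral_add, integral_add, integral_add, integral_add,
    integral_const_mul, integral_const_mul, integral_const_mul,
    integral_normSq_add_mul_sq μ hij k (by simp), integral_normSq_add_mul_sq μ hij k (by simp),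
    integral_normSq_add_mul_sq μ hij k (by simp), integral_normSq_add_mul_sq μ hij k (by simp),
    ← integral_normSq_sq_eq μ i j k] at h
  · linarith
  all_goals exact integrable_of_continuous (by fun_prop)

theorem integral_normSq_mul_normSq (i j k : n) :
    ∫ U : unitaryGroup n ℂ, Complex.normSq ((U : Matrix n n ℂ) i k) *
        Complex.normSq ((U : Matrix n n ℂ) j k) ∂μ =
      (1 + if i = j then 1 else 0) / (Fintype.card n * (Fintype.card n + 1)) := by
  set a := ∫ U : unitaryGroup n ℂ, Complex.normSq ((U : Matrix n n ℂ) k k) ^ 2 ∂μ with ha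
  have hval (i j : n) : ∫ U : unitaryGroup n ℂ, Complex.normSq ((U : Matrix n n ℂ) i k) *
      Complex.normSq ((U : Matrix n n ℂ) j k) ∂μ = (1 + if i = j then 1 else 0) * (a / 2) := by
    rw [ha, integral_normSq_sq_eq μ k i k]
    split_ifs with h
    · subst h
      simp_rw [← sq]
      ring
    · rw [integral_normSq_sq_eq_two_mul μ h k]
      ring
  have hsum : ∑ i, ∑ j, ∫ U : unitaryGroup n ℂ, Complex.normSq ((U : Matrix n n ℂ) i k) *
      Complex.normSq ((U : Matrix n n ℂ) j k) ∂μ = 1 := by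
    have hint (i j : n) : Integrable (fun U : unitaryGroup n ℂ =>
        Complex.normSq ((U : Matrix n n ℂ) i k) * Complex.normSq ((U : Matrix n n ℂ) j k)) μ :=
      integrable_of_continuous ((continuous_normSq_entry i k).mul (continuous_normSq_entry j k))
    simp_rw [← integral_finsetSum _ fun j _ => hint _ j]
    rw [← integral_finsetSum _ fun i _ => integrable_finsetSum _ fun j _ => hint i j]
    simp_rw [← Finset.sum_mul_sum, sum_normSq_col]
    simp
  simp only [hval, ← Finset.sum_mul, Finset.sum_add_distrib, Finset.sum_ite_eq,
    Finset.mem_univ, if_true, Finset.sum_const, Finset.card_univ, nsmul_eq_mul, mul_one] at hsum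
  have hn : (0 : ℝ) < Fintype.card n := by exact_mod_cast Fintype.card_pos_iff.mpr ⟨k⟩
  rw [hval, mul_div_assoc', div_eq_div_iff two_ne_zero (by positivity)]
  linear_combination 2 * (1 + if i = j then 1 else 0) * hsum

theorem integral_sum_mul_normSq_sq (c : n → ℝ) (k : n) :
    ∫ U : unitaryGroup n ℂ, (∑ i, c i * Complex.normSq ((U : Matrix n n ℂ) i k)) ^ 2 ∂μ =
      ((∑ i, c i) ^ 2 + ∑ i, c i ^ 2) / (Fintype.card n * (Fintype.card n + 1)) := by
  have hint (i j : n) : Integrable (fun U : unitaryGroup n ℂ => c i * c j *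
      (Complex.normSq ((U : Matrix n n ℂ) i k) * Complex.normSq ((U : Matrix n n ℂ) j k))) μ :=
    integrable_of_continuous (continuous_const.mul
      ((continuous_normSq_entry i k).mul (continuous_normSq_entry j k)))
  simp_rw [sq (∑ i, _), Finset.sum_mul_sum, mul_mul_mul_comm (c _) (Complex.normSq _)]
  rw [integral_finsetSum _ fun i _ => integrable_finsetSum _ fun j _ => hint i j]
  simp_rw [integral_finsetSum _ fun j _ => hint _ j, integral_const_mul,
    integral_normSq_mul_normSq, mul_div_assoc', ← Finset.sum_div, mul_add, Finset.sum_add_distrib]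
  simp [sq]

theorem integral_normSq_conj_of_isHermitian {H : Matrix n n ℂ} (hH : H.IsHermitian) (k : n) :
    ∫ U : unitaryGroup n ℂ, Complex.normSq
        (((U : Matrix n n ℂ)ᴴ * H * (U : Matrix n n ℂ)) k k) ∂μ =
      (Complex.normSq H.trace + (H * H).trace.re) /
        (Fintype.card n * (Fintype.card n + 1)) := by
  set V := hH.eigenvectorUnitary
  set D : Matrix n n ℂ := diagonal (RCLike.ofReal ∘ hH.eigenvalues) with hD
  have hVV : (V : Matrix n n ℂ)ᴴ * V = 1 := UnitaryGroup.star_mul_self V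
  have hspec : H = V * D * (V : Matrix n n ℂ)ᴴ := by
    have h := hH.spectral_theorem
    rwa [Unitary.conjStarAlgAut_apply] at h
  have htr : H.trace = ((∑ i, hH.eigenvalues i : ℝ) : ℂ) := by
    rw [hH.trace_eq_sum_eigenvalues]
    simp
  have htr2 : (H * H).trace = ((∑ i, hH.eigenvalues i ^ 2 : ℝ) : ℂ) := by
    have : H * H = V * (D * D) * (V : Matrix n n ℂ)ᴴ := by
      conv_lhs => rw [hspec]
      simp only [Matrix.mul_assoc]
      rw [← Matrix.mul_assoc (V : Matrix n n ℂ)ᴴ (V : Matrix n n ℂ), hVV, Matrix.one_mul]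
    rw [this, trace_mul_comm, ← Matrix.mul_assoc, hVV, Matrix.one_mul, hD, diagonal_mul_diagonal,
      trace_diagonal]
    simp [sq]
  have hquad (U : unitaryGroup n ℂ) :
      Complex.normSq (((U : Matrix n n ℂ)ᴴ * H * (U : Matrix n n ℂ)) k k) =
      (∑ i, hH.eigenvalues i *
        Complex.normSq (((V⁻¹ * U : unitaryGroup n ℂ) : Matrix n n ℂ) i k)) ^ 2 := by
    have h1 : (U : Matrix n n ℂ)ᴴ * H * (U : Matrix n n ℂ) =
        ((V⁻¹ * U : unitaryGroup n ℂ) : Matrix n n ℂ)ᴴ *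
          (D * ((V⁻¹ * U : unitaryGroup n ℂ) : Matrix n n ℂ)) := by
      have h2 : ((V⁻¹ * U : unitaryGroup n ℂ) : Matrix n n ℂ) = (V : Matrix n n ℂ)ᴴ * U := rfl
      rw [h2, conjTranspose_mul, conjTranspose_conjTranspose]
      conv_lhs => rw [hspec]
      simp only [Matrix.mul_assoc]
    have h3 : ((U : Matrix n n ℂ)ᴴ * H * (U : Matrix n n ℂ)) k k =
        ((∑ i, hH.eigenvalues i *
          Complex.normSq (((V⁻¹ * U : unitaryGroup n ℂ) : Matrix n n ℂ) i k) : ℝ) : ℂ) := by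
      rw [h1, Matrix.mul_apply, Complex.ofReal_sum]
      refine Finset.sum_congr rfl fun i _ => ?_
      rw [hD, diagonal_mul, conjTranspose_apply, Complex.ofReal_mul,
        Complex.normSq_eq_conj_mul_self, Complex.star_def, mul_left_comm]
      rfl
    rw [h3, Complex.normSq_ofReal, sq]
  simp_rw [hquad]
  rw [integral_mul_left_eq_self (fun U : unitaryGroup n ℂ =>
    (∑ i, hH.eigenvalues i * Complex.normSq ((U : Matrix n n ℂ) i k)) ^ 2) V⁻¹,
    integral_sum_mul_normSq_sq, htr, htr2, Complex.normSq_ofReal, Complex.ofReal_re, sq]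

theorem integral_normSq_conj (A : Matrix n n ℂ) (k : n) :
    ∫ U : unitaryGroup n ℂ, Complex.normSq
        (((U : Matrix n n ℂ)ᴴ * A * (U : Matrix n n ℂ)) k k) ∂μ =
      (Complex.normSq A.trace + (A * Aᴴ).trace.re) /
        (Fintype.card n * (Fintype.card n + 1)) := by
  obtain ⟨H, K, hH, hK, rfl⟩ : ∃ H K : Matrix n n ℂ,
      H.IsHermitian ∧ K.IsHermitian ∧ A = H + Complex.I • K :=
    ⟨realPart A, imaginaryPart A, (realPart A).2, (imaginaryPart A).2,
      (realPart_add_I_smul_imaginaryPart A).symm⟩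
  have him {B : Matrix n n ℂ} (hB : B.IsHermitian) (i : n) : (B i i).im = 0 :=
    Complex.conj_eq_iff_im.mp (hB.apply i i)
  have hns {x y : ℂ} (hx : x.im = 0) (hy : y.im = 0) :
      Complex.normSq (x + Complex.I * y) = Complex.normSq x + Complex.normSq y := by
    simp [Complex.normSq_apply, hx, hy]
  have htr {B : Matrix n n ℂ} (hB : B.IsHermitian) : B.trace.im = 0 := by
    simp [trace, him hB]
  have hcont (B : Matrix n n ℂ) : Integrable (fun U : unitaryGroup n ℂ => Complex.normSq
      (((U : Matrix n n ℂ)ᴴ * B * (U : Matrix n n ℂ)) k k)) μ :=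
    integrable_of_continuous (Complex.continuous_normSq.comp
      (((continuous_subtype_val.matrix_conjTranspose.matrix_mul continuous_const).matrix_mul
        continuous_subtype_val).matrix_elem k k))
  have hpt (U : unitaryGroup n ℂ) : Complex.normSq
      (((U : Matrix n n ℂ)ᴴ * (H + Complex.I • K) * (U : Matrix n n ℂ)) k k) =
      Complex.normSq (((U : Matrix n n ℂ)ᴴ * H * (U : Matrix n n ℂ)) k k) +
      Complex.normSq (((U : Matrix n n ℂ)ᴴ * K * (U : Matrix n n ℂ)) k k) := by
    rw [Matrix.mul_add, Matrix.add_mul, Matrix.mul_smul, Matrix.smul_mul, add_apply, smul_apply,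
      smul_eq_mul]
    exact hns (him (isHermitian_conjTranspose_mul_mul _ hH) k)
      (him (isHermitian_conjTranspose_mul_mul _ hK) k)
  have htrA : Complex.normSq (H + Complex.I • K).trace =
      Complex.normSq H.trace + Complex.normSq K.trace := by
    rw [trace_add, trace_smul, smul_eq_mul, hns (htr hH) (htr hK)]
  have htrAA : ((H + Complex.I • K) * (H + Complex.I • K)ᴴ).trace =
      (H * H).trace + (K * K).trace := by
    rw [conjTranspose_add, conjTranspose_smul, hH.eq, hK.eq]
    simp only [Matrix.mul_add, Matrix.add_mul, Matrix.mul_smul, Matrix.smul_mul, trace_add,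
      trace_smul, smul_eq_mul, trace_mul_comm K H, Complex.star_def, Complex.conj_I]
    linear_combination -(K * K).trace * Complex.I_mul_I
  simp_rw [hpt]
  rw [integral_add (hcont H) (hcont K), integral_normSq_conj_of_isHermitian μ hH,
    integral_normSq_conj_of_isHermitian μ hK, htrA, htrAA, Complex.add_re]
  ring

end Matrix.UnitaryGroup

/-- **Second moment of a conjugated observable at a basis state.**
For every `d ≥ 1` and every `A ∈ M_d(ℂ)`, with `U` Haar-distributed on `U(d)`
(`μ` the Haar probability measure),
`∫ |⟨e₀| U† A U |e₀⟩|² dμ(U) = (|Tr A|² + Tr(A A†)) / (d(d+1))`.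
In particular, if `A` is traceless with `Tr(A A†) = d`, this expectation equals `1/(d+1)`. -/
theorem haar_second_moment_basis_expectation
    (d : ℕ) (hd : 1 ≤ d) (A : Matrix (Fin d) (Fin d) ℂ)
    (μ : Measure (Matrix.unitaryGroup (Fin d) ℂ)) [μ.IsHaarMeasure]
    [IsProbabilityMeasure μ] :
    (∫ U : Matrix.unitaryGroup (Fin d) ℂ,
        Complex.normSq
          (((U : Matrix (Fin d) (Fin d) ℂ)ᴴ * A * (U : Matrix (Fin d) (Fin d) ℂ))
            ⟨0, by omega⟩ ⟨0, by omega⟩) ∂μ)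
      = (Complex.normSq A.trace + (A * Aᴴ).trace.re) / (d * (d + 1))
    ∧ (A.trace = 0 → (A * Aᴴ).trace = (d : ℂ) →
        (∫ U : Matrix.unitaryGroup (Fin d) ℂ,
            Complex.normSq
              (((U : Matrix (Fin d) (Fin d) ℂ)ᴴ * A * (U : Matrix (Fin d) (Fin d) ℂ))
                ⟨0, by omega⟩ ⟨0, by omega⟩) ∂μ)
          = 1 / (d + 1)) := by
  have h := Matrix.UnitaryGroup.integral_normSq_conj μ A ⟨0, by omega⟩
  rw [Fintype.card_fin] at h
  refine ⟨h, fun htr hA => ?_⟩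
  have hd' : (0 : ℝ) < d := by exact_mod_cast hd
  rw [h, htr, hA, map_zero, zero_add, Complex.natCast_re]
  field_simp

end
end

section
/- Fast scrambling of a single-qubit error by shallow random circuits: for every even n ≥ 2 and every depth l ≥ 1, E_{C∼RQC(n,l)} |⟨0^n| C† X₁ C |0^n⟩|² ≤ (4/15)·(4/5)^{2(l−1)} + 1/(2^n + 1), where X₁ denotes the Pauli X matrix acting on the first qubit (tensored with the identity on the remaining n−1 qubits). -/
open MeasureTheory Matrix

noncomputable section

/-- Computational basis labels of an `n`-qubit system. -/
abbrev QIdx (n : ℕ) := Fin n → Fin 2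

/-- The single-qubit Pauli matrices `I, X, Y, Z`. -/
def Pauli : Fin 4 → Matrix (Fin 2) (Fin 2) ℂ
  | 0 => 1
  | 1 => !![0, 1; 1, 0]
  | 2 => !![0, -Complex.I; Complex.I, 0]
  | 3 => !![1, 0; 0, -1]

/-- The `n`-qubit Pauli string `σ_α = ⨂ᵢ Pauli (α i)`. -/
def pauliString {n : ℕ} (α : Fin n → Fin 4) : Matrix (QIdx n) (QIdx n) ℂ :=
  Matrix.of fun x y => ∏ i, Pauli (α i) (x i) (y i)

/-- Pauli `X` acting on qubit `i` (identity elsewhere). -/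
def pauliXat {n : ℕ} (i : Fin n) : Matrix (QIdx n) (QIdx n) ℂ :=
  pauliString (fun k => if k = i then 1 else 0)

/-- A two-qubit gate, as a matrix indexed by pairs of qubit basis labels. -/
abbrev Gate2 := Matrix (Fin 2 × Fin 2) (Fin 2 × Fin 2) ℂ

/-- Odd brickwork layer on `n = 2m` qubits: gates on pairs `(0,1), (2,3), …, (2m-2, 2m-1)`. -/
def layerOdd {m : ℕ} (g : Fin m → Gate2) : Matrix (QIdx (2 * m)) (QIdx (2 * m)) ℂ :=
  Matrix.of fun x y => ∏ j : Fin m,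
    g j (x ⟨2 * j.1, by have := j.2; omega⟩, x ⟨2 * j.1 + 1, by have := j.2; omega⟩)
        (y ⟨2 * j.1, by have := j.2; omega⟩, y ⟨2 * j.1 + 1, by have := j.2; omega⟩)

/-- Even brickwork layer on the ring of `n = 2m` qubits:
gates on pairs `(1,2), (3,4), …, (2m-1, 0)` (indices mod `2m`). -/
def layerEven {m : ℕ} (g : Fin m → Gate2) : Matrix (QIdx (2 * m)) (QIdx (2 * m)) ℂ :=
  Matrix.of fun x y => ∏ j : Fin m,
    g j (x ⟨2 * j.1 + 1, by have := j.2; omega⟩,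
         x ⟨(2 * j.1 + 2) % (2 * m), Nat.mod_lt _ (by have := j.2; omega)⟩)
        (y ⟨2 * j.1 + 1, by have := j.2; omega⟩,
         y ⟨(2 * j.1 + 2) % (2 * m), Nat.mod_lt _ (by have := j.2; omega)⟩)

/-- Layer `L_{t+1}` of the brickwork circuit (`t` is the 0-based layer index;
`L_1` is an odd layer, `L_2` an even layer, and so on, alternating). -/
def brickLayer {m : ℕ} (t : ℕ) (g : Fin m → Gate2) : Matrix (QIdx (2 * m)) (QIdx (2 * m)) ℂ :=
  if t % 2 = 0 then layerOdd g else layerEven g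

/-- An assignment of a two-qubit gate to each (layer, pair) position. -/
abbrev GateAssign (m d : ℕ) := Fin d → Fin m → Gate2

/-- The circuit `C = L_d ⋯ L_1` built from the gate assignment `G`. -/
def circuitOf {m d : ℕ} (G : GateAssign m d) : Matrix (QIdx (2 * m)) (QIdx (2 * m)) ℂ :=
  (List.finRange d).foldl (fun M t => brickLayer t.1 (G t) * M) 1

/-- The group of two-qubit unitary gates `U(4)`. -/
abbrev U4 := Matrix.unitaryGroup (Fin 2 × Fin 2) ℂ

/-- The gate assignment obtained from a point of the product sample space. -/
def gatesOf {m d : ℕ} (ω : Fin d × Fin m → U4) : GateAssign m d :=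
  fun t j => (ω (t, j) : Gate2)

/-- The basis label `0ⁿ` of `|0^n⟩`. -/
def allZero (n : ℕ) : QIdx n := fun _ => 0

/-- `⟨0^n| C† A C |0^n⟩` for an `n`-qubit matrix `A` and circuit `C`. -/
def zeroExp {n : ℕ} (C A : Matrix (QIdx n) (QIdx n) ℂ) : ℂ :=
  (Cᴴ * A * C) (allZero n) (allZero n)

end

noncomputable section

instance : SecondCountableTopology U4 :=
  have : SecondCountableTopology (Matrix (Fin 2 × Fin 2) (Fin 2 × Fin 2) ℂ) :=
    inferInstanceAs (SecondCountableTopology (Fin 2 × Fin 2 → Fin 2 × Fin 2 → ℂ))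
  TopologicalSpace.Subtype.secondCountableTopology _

instance : CompactSpace U4 := by
  refine isCompact_iff_compactSpace.mp ?_
  have hK : IsCompact (X := Gate2) (Set.pi Set.univ fun _ : Fin 2 × Fin 2 => Set.pi Set.univ
      fun _ : Fin 2 × Fin 2 => Metric.closedBall (0 : ℂ) 1) :=
    isCompact_univ_pi fun _ => isCompact_univ_pi fun _ => isCompact_closedBall 0 1
  refine hK.of_isClosed_subset (isClosed_unitary (R := Gate2)) fun g hg a _ b _ => ?_
  simpa using entry_norm_bound_of_unitary hg a b

theorem isMulRightInvariant_of_compact {G : Type*} [Group G] [TopologicalSpace G]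
    [IsTopologicalGroup G] [CompactSpace G] [MeasurableSpace G] [BorelSpace G]
    (μ : Measure G) [μ.IsHaarMeasure] [IsProbabilityMeasure μ] : μ.IsMulRightInvariant where
  map_mul_right_eq_self g := by
    have : IsProbabilityMeasure (μ.map (· * g)) :=
      Measure.isProbabilityMeasure_map (measurable_mul_const g).aemeasurable
    exact Measure.isHaarMeasure_eq_of_isProbabilityMeasure _ _

/-- The complex conjugation pattern of the four replicas `ψ̄ ⊗ ψ ⊗ ψ̄ ⊗ ψ`. -/
def conjAt (c : Fin 4) : ℂ →+* ℂ := if c = 0 ∨ c = 2 then starRingEnd ℂ else RingHom.id ℂ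

/-- The entries of the replicated matrix `M̄ ⊗ M ⊗ M̄ ⊗ M`. -/
def repl {α β : Type*} (M : Matrix α β ℂ) (u : Fin 4 → α) (u' : Fin 4 → β) : ℂ :=
  ∏ c, conjAt c (M (u c) (u' c))

/-- The two ways of contracting conjugated with unconjugated replicas: `false` pairs replicas
`(0, 1)` and `(2, 3)` (the identity), `true` pairs `(0, 3)` and `(2, 1)` (the swap). -/
def pairing {α : Type*} [DecidableEq α] (b : Bool) (u : Fin 4 → α) : ℂ :=
  if b then (if u 0 = u 3 then 1 else 0) * (if u 2 = u 1 then 1 else 0)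
  else (if u 0 = u 1 then 1 else 0) * (if u 2 = u 3 then 1 else 0)

theorem pairing_vec {α : Type*} [DecidableEq α] (b : Bool) (x y z w : α) :
    pairing b ![x, y, z, w] = if b then (if x = w then 1 else 0) * (if z = y then 1 else 0)
      else (if x = y then 1 else 0) * (if z = w then 1 else 0) := rfl

theorem repl_eq {α β : Type*} (M : Matrix α β ℂ) (u : Fin 4 → α) (u' : Fin 4 → β) :
    repl M u u' = star (M (u 0) (u' 0)) * M (u 1) (u' 1) * star (M (u 2) (u' 2))
      * M (u 3) (u' 3) := by
  simp [repl, conjAt, Fin.prod_univ_four]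

theorem repl_mul {α β γ : Type*} [Fintype β] [DecidableEq β] (M : Matrix α β ℂ) (N : Matrix β γ ℂ)
    (u : Fin 4 → α) (u' : Fin 4 → γ) :
    repl (M * N) u u' = ∑ w : Fin 4 → β, repl M u w * repl N w u' := by
  simp only [repl, Matrix.mul_apply, map_sum, map_mul, Finset.prod_univ_sum,
    Fintype.piFinset_univ, Finset.prod_mul_distrib]

theorem sum_fin_four {α : Type*} [Fintype α] (f : (Fin 4 → α) → ℂ) :
    ∑ u, f u = ∑ x, ∑ y, ∑ z, ∑ w, f ![x, y, z, w] := by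
  let e : (Fin 4 → α) ≃ α × α × α × α :=
    { toFun := fun v => (v 0, v 1, v 2, v 3)
      invFun := fun p => ![p.1, p.2.1, p.2.2.1, p.2.2.2]
      left_inv := fun v => by ext i; fin_cases i <;> rfl
      right_inv := fun _ => rfl }
  rw [← e.symm.sum_comp]
  simp only [Fintype.sum_prod_type]
  rfl

theorem sum_repl_mul_pairing {α : Type*} [Fintype α] [DecidableEq α]
    (g : Matrix.unitaryGroup α ℂ) (b : Bool) (u : Fin 4 → α) :
    ∑ u', repl (g : Matrix α α ℂ) u u' * pairing b u' = pairing b u := by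
  have h (x y : α) : ∑ z, star (g.1 x z) * g.1 y z = if x = y then 1 else 0 := by
    have := congrFun (congrFun (Matrix.mem_unitaryGroup_iff.mp g.2) y) x
    simp only [Matrix.mul_apply, Matrix.star_apply, Matrix.one_apply] at this
    simp_rw [mul_comm (star _), this, eq_comm]
  have hf : pairing b u = if b then
      (∑ z, star (g.1 (u 0) z) * g.1 (u 3) z) * ∑ z, star (g.1 (u 2) z) * g.1 (u 1) z else
      (∑ z, star (g.1 (u 0) z) * g.1 (u 1) z) * ∑ z, star (g.1 (u 2) z) * g.1 (u 3) z := by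
    simp only [h, pairing]
  rw [hf, sum_fin_four]
  simp only [repl_eq, pairing_vec, Finset.sum_mul_sum]
  cases b
  · simp [mul_assoc]
  · simp
    refine Finset.sum_congr rfl fun x _ => Finset.sum_congr rfl fun y _ => ?_
    ring

theorem Continuous.repl {X α β : Type*} [TopologicalSpace X] {M : X → Matrix α β ℂ}
    (hM : Continuous M) (u : Fin 4 → α) (u' : Fin 4 → β) :
    Continuous fun x => repl (M x) u u' := by
  simp only [repl_eq]
  have h (a b) : Continuous fun x => M x a b := hM.matrix_elem a b
  fun_prop

/-- The second moment tensor `E[ḡ ⊗ g ⊗ ḡ ⊗ g]` of a random gate. -/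
def moment (μ : Measure U4) (u u' : Fin 4 → Fin 2 × Fin 2) : ℂ :=
  ∫ g : U4, repl (g : Gate2) u u' ∂μ

section Twirl

variable (μ : Measure U4) [μ.IsHaarMeasure] [IsProbabilityMeasure μ]

omit [IsProbabilityMeasure μ] in
theorem integrable_repl (u u' : Fin 4 → Fin 2 × Fin 2) :
    Integrable (fun g : U4 => repl (g : Gate2) u u') μ :=
  (continuous_subtype_val.repl u u').integrable_of_hasCompactSupport
    (HasCompactSupport.of_compactSpace _)

theorem moment_eq_sum_moment_mul_repl (h : U4) (u u' : Fin 4 → Fin 2 × Fin 2) :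
    moment μ u u' = ∑ w, moment μ u w * repl (h : Gate2) w u' := by
  have := isMulRightInvariant_of_compact μ
  rw [moment, ← integral_mul_right_eq_self _ h]
  simp only [Submonoid.coe_mul, repl_mul]
  rw [integral_finsetSum _ fun w _ => (integrable_repl μ u w).mul_const _]
  simp only [integral_mul_const, moment]

theorem sum_moment_mul_pairing (b : Bool) (u : Fin 4 → Fin 2 × Fin 2) :
    ∑ u', moment μ u u' * pairing b u' = pairing b u := by
  simp only [moment, ← integral_mul_const]
  rw [← integral_finsetSum _ fun w _ => (integrable_repl μ u w).mul_const _]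
  simp [sum_repl_mul_pairing]

end Twirl

/-- Invariance of a four-replica tensor on two qubits under all local unitaries. -/
def IsReplInvariant (f : (Fin 4 → Fin 2 × Fin 2) → ℂ) : Prop :=
  ∀ (h : U4) (u : Fin 4 → Fin 2 × Fin 2), f u = ∑ w, f w * repl (h : Gate2) w u

namespace IsReplInvariant

variable {f : (Fin 4 → Fin 2 × Fin 2) → ℂ}

theorem eq_comp_perm (hf : IsReplInvariant f) (σ : Equiv.Perm (Fin 2 × Fin 2))
    (u : Fin 4 → Fin 2 × Fin 2) : f u = f (σ ∘ u) := by
  let h : Gate2 := Matrix.of fun i j => if i = σ j then 1 else 0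
  have hh : h ∈ U4 := by
    rw [Matrix.mem_unitaryGroup_iff']
    ext i j
    simp [h, Matrix.mul_apply, Matrix.star_apply, Matrix.one_apply, eq_comm]
  have hr (w : Fin 4 → Fin 2 × Fin 2) : repl h w u = if w = σ ∘ u then 1 else 0 := by
    split_ifs with hw
    · simp [hw, h, repl]
    · obtain ⟨c, hc⟩ := Function.ne_iff.mp hw
      exact Finset.prod_eq_zero (Finset.mem_univ c) (by simpa [h] using hc)
  rw [hf ⟨h, hh⟩ u]
  simp [hr]

theorem eq_mul_phase (hf : IsReplInvariant f) (a : Fin 2 × Fin 2) (u : Fin 4 → Fin 2 × Fin 2) :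
    f u = f u * ∏ c, conjAt c (if u c = a then Complex.I else 1) := by
  let h : Gate2 := Matrix.diagonal fun i => if i = a then Complex.I else 1
  have hh : h ∈ U4 := by
    rw [Matrix.mem_unitaryGroup_iff', Matrix.star_eq_conjTranspose, Matrix.diagonal_conjTranspose,
      Matrix.diagonal_mul_diagonal, ← Matrix.diagonal_one]
    congr 1
    ext i
    by_cases hi : i = a <;> simp [hi]
  have hr (w : Fin 4 → Fin 2 × Fin 2) : repl h w u =
      if w = u then ∏ c, conjAt c (if u c = a then Complex.I else 1) else 0 := by
    split_ifs with hw
    · simp [hw, h, repl]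
    · obtain ⟨c, hc⟩ := Function.ne_iff.mp hw
      exact Finset.prod_eq_zero (Finset.mem_univ c) (by simp [h, Matrix.diagonal_apply_ne _ hc])
  conv_lhs => rw [hf ⟨h, hh⟩ u]
  simp [hr]

theorem eq_zero (hf : IsReplInvariant f) (u : Fin 4 → Fin 2 × Fin 2)
    (h₁ : ¬ (u 0 = u 1 ∧ u 2 = u 3)) (h₂ : ¬ (u 0 = u 3 ∧ u 2 = u 1)) : f u = 0 := by
  have key (a) : f u = 0 ∨ ∏ c, conjAt c (if u c = a then Complex.I else 1) = 1 := by
    by_contra! hne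
    exact hne.2 (mul_left_cancel₀ hne.1 (by rw [← hf.eq_mul_phase, mul_one]))
  by_cases h01 : u 0 = u 1
  · have h23 : u 3 ≠ u 2 := fun h => h₁ ⟨h01, h.symm⟩
    refine (key (u 2)).resolve_right ?_
    by_cases h : u 1 = u 2 <;>
      simp [Fin.prod_univ_four, conjAt, Complex.ext_iff, h01, h23, h]
  · by_cases h03 : u 0 = u 3
    · have h21 : u 1 ≠ u 2 := fun h => h₂ ⟨h03, h.symm⟩
      refine (key (u 2)).resolve_right ?_
      by_cases h : u 3 = u 2 <;>
        simp [Fin.prod_univ_four, conjAt, Complex.ext_iff, h03, h21, h]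
    · refine (key (u 0)).resolve_right ?_
      by_cases h : u 2 = u 0 <;>
        norm_num [Fin.prod_univ_four, conjAt, Complex.ext_iff, Ne.symm h01, Ne.symm h03, h]

theorem sum_eq (hf : IsReplInvariant f) : ∑ w, f w = 16 * f fun _ => 0 := by
  let h : Gate2 := Matrix.of fun i j =>
    (1 / 2) * (if i.1 = 1 ∧ j.1 = 1 then -1 else 1) * (if i.2 = 1 ∧ j.2 = 1 then -1 else 1)
  have hh : h ∈ U4 := by
    rw [Matrix.mem_unitaryGroup_iff']
    ext ⟨i, i'⟩ ⟨j, j'⟩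
    fin_cases i <;> fin_cases i' <;> fin_cases j <;> fin_cases j' <;>
      norm_num [h, Matrix.mul_apply, Matrix.star_apply, Matrix.one_apply, Fintype.sum_prod_type,
        map_ofNat]
  rw [hf ⟨h, hh⟩, Finset.mul_sum]
  refine Finset.sum_congr rfl fun w _ => ?_
  norm_num [repl_eq, h]
  ring

theorem exists_eq_pairing (hf : IsReplInvariant f) :
    ∃ a b, ∀ u, f u = a * pairing false u + b * pairing true u := by
  have htrans : ∀ x y : Fin 2 × Fin 2, x ≠ y →
      (Equiv.swap (Equiv.swap (0, 0) x (0, 1)) y * Equiv.swap (0, 0) x) (0, 0) = x ∧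
      (Equiv.swap (Equiv.swap (0, 0) x (0, 1)) y * Equiv.swap (0, 0) x) (0, 1) = y := by decide
  have hvec (u : Fin 4 → Fin 2 × Fin 2) : u = ![u 0, u 1, u 2, u 3] := by
    ext i : 1; fin_cases i <;> rfl
  have hcomp (σ : Fin 2 × Fin 2 → Fin 2 × Fin 2) (x y z w) :
      σ ∘ ![x, y, z, w] = ![σ x, σ y, σ z, σ w] := by
    ext i : 1; fin_cases i <;> rfl
  set a := f ![(0, 0), (0, 0), (0, 1), (0, 1)] with ha
  set b := f ![(0, 0), (0, 1), (0, 1), (0, 0)] with hb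
  set c := f fun _ => 0 with hc
  have hfa (x y) (h : x ≠ y) : f ![x, x, y, y] = a := by
    rw [ha, hf.eq_comp_perm _ ![(0, 0), (0, 0), (0, 1), (0, 1)], hcomp, (htrans x y h).1,
      (htrans x y h).2]
  have hfb (x y) (h : x ≠ y) : f ![x, y, y, x] = b := by
    rw [hb, hf.eq_comp_perm _ ![(0, 0), (0, 1), (0, 1), (0, 0)], hcomp, (htrans x y h).1,
      (htrans x y h).2]
  have hfc (x) : f ![x, x, x, x] = c := by
    have h0 : (fun _ => 0 : Fin 4 → Fin 2 × Fin 2) = ![0, 0, 0, 0] := hvec _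
    rw [hc, h0, hf.eq_comp_perm (Equiv.swap 0 x) ![0, 0, 0, 0], hcomp, Equiv.swap_apply_left]
  have hform (u) : f u = a * pairing false u + b * pairing true u
      + (c - a - b) * (pairing false u * pairing true u) := by
    by_cases h₁ : u 0 = u 1 ∧ u 2 = u 3
    · rw [hvec u, ← h₁.1, ← h₁.2]
      by_cases h : u 0 = u 2
      · rw [← h, hfc]
        simp [pairing_vec]
      · rw [hfa _ _ h]
        simp [pairing_vec, h]
    · by_cases h₂ : u 0 = u 3 ∧ u 2 = u 1
      · have h : u 0 ≠ u 1 := fun h => h₁ ⟨h, by rw [h₂.2, ← h, h₂.1]⟩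
        rw [hvec u, ← h₂.1, h₂.2, hfb _ _ h]
        simp [pairing_vec, h]
      · rw [hf.eq_zero u h₁ h₂]
        rw [not_and_or] at h₁ h₂
        rcases h₁ with h₁ | h₁ <;> rcases h₂ with h₂ | h₂ <;> simp [pairing, h₁, h₂]
  refine ⟨a, b, fun u => ?_⟩
  have hsum := hf.sum_eq
  simp only [hform, Finset.sum_add_distrib, ← Finset.mul_sum, sum_fin_four, pairing_vec] at hsum
  have h0 : c - a - b = 0 := by
    simp [pairing] at hsum
    linear_combination -hsum / 12
  rw [hform, h0]
  ring

end IsReplInvariant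

theorem pairing_prod {α β : Type*} [DecidableEq α] [DecidableEq β] (b : Bool)
    (u : Fin 4 → α × β) :
    pairing b u = pairing b (Prod.fst ∘ u) * pairing b (Prod.snd ∘ u) := by
  cases b <;> simp only [pairing, Prod.ext_iff, Function.comp_apply, ite_and, if_true,
    Bool.false_eq_true, if_false] <;> split_ifs <;> simp

theorem sum_pairing_mul_pairing (α : Type*) [Fintype α] [DecidableEq α] (b b' : Bool) :
    ∑ u : Fin 4 → α, pairing b u * pairing b' u =
      if b = b' then (Fintype.card α : ℂ) ^ 2 else Fintype.card α := by
  rw [sum_fin_four]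
  cases b <;> cases b' <;> simp [pairing_vec, sq]

/-- The contraction of a one-qubit four-replica tensor with a pairing. -/
def overlap (b : Bool) (φ : (Fin 4 → Fin 2) → ℂ) : ℂ := ∑ r, φ r * pairing b r

theorem overlap_pairing (b s : Bool) : overlap b (pairing s) = if b = s then 4 else 2 := by
  rw [overlap, sum_pairing_mul_pairing]
  simp only [eq_comm (a := s)]
  norm_num

/-- The coefficient of the pairing `b` in the gate average of the observable `φ ⊗ φ'`. -/
def gateCoeff (φ φ' : (Fin 4 → Fin 2) → ℂ) (b : Bool) : ℂ :=
  (4 * (overlap b φ * overlap b φ') - overlap (!b) φ * overlap (!b) φ') / 60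

section Twirl

variable (μ : Measure U4) [μ.IsHaarMeasure] [IsProbabilityMeasure μ]

theorem sum_mul_moment (T : (Fin 4 → Fin 2 × Fin 2) → ℂ) (u' : Fin 4 → Fin 2 × Fin 2) :
    ∑ u, T u * moment μ u u' = ∑ b, (4 * (∑ u, T u * pairing b u)
      - ∑ u, T u * pairing (!b) u) / 60 * pairing b u' := by
  set f := fun u' => ∑ u, T u * moment μ u u' with hf
  have hinv : IsReplInvariant f := fun h u => by
    simp only [hf, Finset.sum_mul]
    rw [Finset.sum_comm]
    refine Finset.sum_congr rfl fun w _ => ?_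
    rw [moment_eq_sum_moment_mul_repl μ h, Finset.mul_sum]
    simp only [mul_assoc]
  have hcontr (b) : ∑ u', f u' * pairing b u' = ∑ u, T u * pairing b u := by
    simp only [hf, Finset.sum_mul]
    rw [Finset.sum_comm]
    simp only [mul_assoc, ← Finset.mul_sum, sum_moment_mul_pairing]
  obtain ⟨x, y, hxy⟩ := hinv.exists_eq_pairing
  simp only [← hcontr]
  simp only [hxy, add_mul, Finset.sum_add_distrib, mul_assoc, ← Finset.mul_sum,
    sum_pairing_mul_pairing]
  change f u' = _
  rw [hxy, Fintype.sum_bool]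
  norm_num
  ring

theorem sum_mul_mul_moment (φ φ' : (Fin 4 → Fin 2) → ℂ) (u' : Fin 4 → Fin 2 × Fin 2) :
    ∑ u : Fin 4 → Fin 2 × Fin 2, φ (Prod.fst ∘ u) * φ' (Prod.snd ∘ u) * moment μ u u' =
      ∑ b, gateCoeff φ φ' b * (pairing b (Prod.fst ∘ u') * pairing b (Prod.snd ∘ u')) := by
  have h (b) : ∑ u : Fin 4 → Fin 2 × Fin 2, φ (Prod.fst ∘ u) * φ' (Prod.snd ∘ u) * pairing b u =
      overlap b φ * overlap b φ' := by
    rw [overlap, overlap, Finset.sum_mul_sum, ← Fintype.sum_prod_type',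
      ← (Equiv.arrowProdEquivProdArrow (Fin 4) (fun _ => Fin 2) (fun _ => Fin 2)).sum_comp]
    refine Finset.sum_congr rfl fun u _ => ?_
    rw [pairing_prod]
    exact mul_mul_mul_comm _ _ _ _
  rw [sum_mul_moment]
  simp only [h, gateCoeff, pairing_prod _ u']

end Twirl

section Layer

variable {J N : Type*} [Fintype J] [Fintype N] [DecidableEq N]

/-- A layer of two-qubit gates, where `e` lists the two qubits that each gate acts on. -/
def layerOf (e : J ⊕ J ≃ N) (g : J → Gate2) : Matrix (N → Fin 2) (N → Fin 2) ℂ :=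
  Matrix.of fun x y => ∏ j, g j (x (e (.inl j)), x (e (.inr j))) (y (e (.inl j)), y (e (.inr j)))

/-- The replica labels of the two qubits that gate `j` acts on. -/
def gatePair (e : J ⊕ J ≃ N) (j : J) (v : Fin 4 → N → Fin 2) : Fin 4 → Fin 2 × Fin 2 :=
  fun c => (v c (e (.inl j)), v c (e (.inr j)))

/-- The gate acting on a given qubit. -/
def gateAt (e : J ⊕ J ≃ N) (i : N) : J := (e.symm i).elim id id

/-- The value of the product observable `⨂ᵢ φ i` on a four-replica tensor `M`. -/
def expect (φ : N → (Fin 4 → Fin 2) → ℂ) (M : (Fin 4 → N → Fin 2) → ℂ) : ℂ :=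
  ∑ v, (∏ i, φ i fun c => v c i) * M v

/-- The action of an averaged layer of gates on four-replica tensors. -/
def layerStep (e : J ⊕ J ≃ N) (μ : Measure U4) (M : (Fin 4 → N → Fin 2) → ℂ)
    (v : Fin 4 → N → Fin 2) : ℂ :=
  ∑ v', (∏ j, moment μ (gatePair e j v) (gatePair e j v')) * M v'

omit [Fintype N] [DecidableEq N] in
theorem repl_layerOf (e : J ⊕ J ≃ N) (g : J → Gate2) (v v' : Fin 4 → N → Fin 2) :
    repl (layerOf e g) v v' = ∏ j, repl (g j) (gatePair e j v) (gatePair e j v') := by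
  simp only [repl, layerOf, Matrix.of_apply, map_prod, gatePair]
  exact Finset.prod_comm

omit [DecidableEq N] in
theorem prod_eq_prod_gate {R : Type*} [CommMonoid R] (e : J ⊕ J ≃ N) (f : N → R) :
    ∏ i, f i = ∏ j, f (e (.inl j)) * f (e (.inr j)) := by
  rw [← e.prod_comp, Fintype.prod_sum_type, Finset.prod_mul_distrib]

variable [DecidableEq J]

theorem sum_prod_gatePair (e : J ⊕ J ≃ N) (F : J → (Fin 4 → Fin 2 × Fin 2) → ℂ) :
    ∑ v, ∏ j, F j (gatePair e j v) = ∏ j, ∑ u, F j u := by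
  let E : (Fin 4 → N → Fin 2) ≃ (J → Fin 4 → Fin 2 × Fin 2) :=
    { toFun := fun v j => gatePair e j v
      invFun := fun w c i => (e.symm i).elim (fun j => (w j c).1) fun j => (w j c).2
      left_inv := fun v => by
        ext c i : 2
        obtain ⟨k, rfl⟩ := e.surjective i
        cases k <;> simp [gatePair]
      right_inv := fun w => by
        ext j c : 2
        simp [gatePair] }
  rw [Finset.prod_univ_sum, Fintype.piFinset_univ, ← E.sum_comp]
  rfl

theorem expect_layerStep (e : J ⊕ J ≃ N) (μ : Measure U4) [μ.IsHaarMeasure]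
    [IsProbabilityMeasure μ] (φ : N → (Fin 4 → Fin 2) → ℂ) (M : (Fin 4 → N → Fin 2) → ℂ) :
    expect φ (layerStep e μ M) =
      ∑ b : J → Bool, (∏ j, gateCoeff (φ (e (.inl j))) (φ (e (.inr j))) (b j)) *
        expect (fun i => pairing (b (gateAt e i))) M := by
  have h (v') : ∑ v, (∏ i, φ i fun c => v c i) *
      ∏ j, moment μ (gatePair e j v) (gatePair e j v') =
      ∑ b : J → Bool, (∏ j, gateCoeff (φ (e (.inl j))) (φ (e (.inr j))) (b j)) *
        ∏ i, pairing (b (gateAt e i)) fun c => v' c i := by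
    simp only [prod_eq_prod_gate e, ← Finset.prod_mul_distrib]
    refine (sum_prod_gatePair e fun j u => φ (e (.inl j)) (Prod.fst ∘ u) *
      φ (e (.inr j)) (Prod.snd ∘ u) * moment μ u (gatePair e j v')).trans ?_
    simp only [sum_mul_mul_moment, Finset.prod_univ_sum, Fintype.piFinset_univ]
    simp [gateAt]
    rfl
  simp only [expect, layerStep, Finset.mul_sum]
  rw [Finset.sum_comm]
  simp only [← mul_assoc, ← Finset.sum_mul, h]
  simp only [Finset.sum_mul]
  rw [Finset.sum_comm]

end Layer

section Circuit

/-- The qubits acted on by the gates of an odd layer. -/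
def oddEquiv (m : ℕ) : Fin m ⊕ Fin m ≃ Fin (2 * m) :=
  Equiv.ofBijective (Sum.elim (fun j => ⟨2 * j.1, by have := j.2; omega⟩)
    fun j => ⟨2 * j.1 + 1, by have := j.2; omega⟩) <| by
    rw [Fintype.bijective_iff_injective_and_card]
    refine ⟨?_, by simp [two_mul]⟩
    rintro (i | i) (j | j) h <;>
      simp only [Sum.elim_inl, Sum.elim_inr, reduceCtorEq, Sum.inl.injEq,
        Sum.inr.injEq, Fin.ext_iff] at h ⊢ <;> omega

/-- The qubits acted on by the gates of an even layer. -/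
def evenEquiv (m : ℕ) : Fin m ⊕ Fin m ≃ Fin (2 * m) :=
  Equiv.ofBijective (Sum.elim (fun j => ⟨2 * j.1 + 1, by have := j.2; omega⟩)
    fun j => ⟨(2 * j.1 + 2) % (2 * m), Nat.mod_lt _ (by have := j.2; omega)⟩) <| by
    rw [Fintype.bijective_iff_injective_and_card]
    refine ⟨?_, by simp [two_mul]⟩
    have hmod (j : Fin m) :
        (2 * j.1 + 2) % (2 * m) = if j.1 + 1 = m then 0 else 2 * j.1 + 2 := by
      have := j.2
      split_ifs with h
      · rw [show 2 * j.1 + 2 = 2 * m by omega, Nat.mod_self]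
      · exact Nat.mod_eq_of_lt (by omega)
    rintro (i | i) (j | j) h <;>
      simp only [Sum.elim_inl, Sum.elim_inr, reduceCtorEq, Sum.inl.injEq,
        Sum.inr.injEq, Fin.ext_iff, hmod] at h ⊢ <;> first | omega | (split_ifs at h <;> omega)

/-- The qubits acted on by the gates of the layer with 0-based index `t`. -/
def brickEquiv (m t : ℕ) : Fin m ⊕ Fin m ≃ Fin (2 * m) :=
  if t % 2 = 0 then oddEquiv m else evenEquiv m

theorem brickLayer_eq_layerOf {m : ℕ} (t : ℕ) (g : Fin m → Gate2) :
    brickLayer t g = layerOf (brickEquiv m t) g := by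
  unfold brickLayer brickEquiv
  split_ifs <;> rfl

theorem circuitOf_succ {m d : ℕ} (G : GateAssign m (d + 1)) :
    circuitOf G = brickLayer d (G (Fin.last d)) * circuitOf fun t => G t.castSucc := by
  simp [circuitOf, List.finRange_succ_last, List.foldl_map]

theorem circuitOf_gatesOf_succ {m d : ℕ} (ω : Fin (d + 1) × Fin m → U4) :
    circuitOf (gatesOf ω) = layerOf (brickEquiv m d) (fun j => (ω (Fin.last d, j) : Gate2)) *
      circuitOf (gatesOf fun p : Fin d × Fin m => ω (p.1.castSucc, p.2)) := by
  rw [circuitOf_succ, brickLayer_eq_layerOf]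
  rfl

/-- Splitting off the gates of the last layer. -/
def splitLast (d m : ℕ) : (Fin d × Fin m) ⊕ Fin m ≃ Fin (d + 1) × Fin m where
  toFun := Sum.elim (fun p => (p.1.castSucc, p.2)) fun j => (Fin.last d, j)
  invFun p := Fin.lastCases (motive := fun _ => (Fin d × Fin m) ⊕ Fin m) (.inr p.2)
    (fun t => .inl (t, p.2)) p.1
  left_inv := by rintro (p | j) <;> simp
  right_inv := by
    rintro ⟨t, j⟩
    induction t using Fin.lastCases <;> simp

variable (μ : Measure U4) [IsProbabilityMeasure μ]

theorem integral_mul_splitLast {d m : ℕ} (A : (Fin d × Fin m → U4) → ℂ)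
    (B : (Fin m → U4) → ℂ) :
    ∫ ω : Fin (d + 1) × Fin m → U4,
      B (fun j => ω (Fin.last d, j)) * A (fun p => ω (p.1.castSucc, p.2)) ∂(Measure.pi fun _ => μ) =
    (∫ ω, B ω ∂(Measure.pi fun _ => μ)) * ∫ ω, A ω ∂(Measure.pi fun _ => μ) := by
  rw [← (measurePreserving_piCongrLeft (fun _ => μ) (splitLast d m)).integral_comp',
    ← (measurePreserving_sumPiEquivProdPi_symm fun _ : (Fin d × Fin m) ⊕ Fin m => μ).integral_comp',
    mul_comm, ← integral_prod_mul]
  refine integral_congr_ae (.of_forall fun ω => ?_)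
  have h (i) := Equiv.piCongrLeft_apply_apply (fun _ : Fin (d + 1) × Fin m => U4) (splitLast d m)
    ((MeasurableEquiv.sumPiEquivProdPi fun _ => U4).symm ω) i
  have h1 (p : Fin d × Fin m) := h (.inl p)
  have h2 (j : Fin m) := h (.inr j)
  change B _ * A _ = A ω.1 * B ω.2
  rw [mul_comm]
  congr 2
  · ext1 p; exact h1 p
  · ext1 j; exact h2 j

theorem continuous_circuitOf (d m : ℕ) :
    Continuous fun ω : Fin d × Fin m → U4 => circuitOf (gatesOf ω) := by
  induction d with
  | zero => exact continuous_const
  | succ d ih =>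
    simp only [circuitOf_gatesOf_succ]
    have h1 : Continuous fun ω : Fin (d + 1) × Fin m → U4 =>
        layerOf (brickEquiv m d) fun j => (ω (Fin.last d, j) : Gate2) := by
      refine continuous_matrix fun x y => ?_
      simp only [layerOf, Matrix.of_apply]
      exact continuous_finsetProd _ fun j _ =>
        (continuous_subtype_val.comp (continuous_apply (Fin.last d, j))).matrix_elem _ _
    have h2 : Continuous fun (ω : Fin (d + 1) × Fin m → U4) (p : Fin d × Fin m) =>
        ω (p.1.castSucc, p.2) := by fun_prop
    have h3 := ih.comp h2
    exact h1.matrix_mul h3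

/-- The averaged four-replica tensor of the state `C|0^n⟩` of a random circuit of depth `d`. -/
def stateMoment (m d : ℕ) (v : Fin 4 → QIdx (2 * m)) : ℂ :=
  ∫ ω : Fin d × Fin m → U4, repl (circuitOf (gatesOf ω)) v (fun _ => allZero _)
    ∂(Measure.pi fun _ => μ)

theorem integrable_repl_circuitOf {m d : ℕ} (v v' : Fin 4 → QIdx (2 * m)) :
    Integrable (fun ω : Fin d × Fin m → U4 => repl (circuitOf (gatesOf ω)) v v')
      (Measure.pi fun _ => μ) :=
  ((continuous_circuitOf d m).repl v v').integrable_of_hasCompactSupport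
    (HasCompactSupport.of_compactSpace _)

theorem stateMoment_zero (m : ℕ) (v : Fin 4 → QIdx (2 * m)) :
    stateMoment μ m 0 v = if v = fun _ => allZero _ then 1 else 0 := by
  have h (ω : Fin 0 × Fin m → U4) : circuitOf (gatesOf ω) = 1 := rfl
  simp only [stateMoment, h, integral_const, probReal_univ, one_smul]
  split_ifs with hv
  · subst hv
    simp [repl]
  · obtain ⟨c, hc⟩ := Function.ne_iff.mp hv
    exact Finset.prod_eq_zero (Finset.mem_univ c) (by simp [Matrix.one_apply_ne hc])

theorem stateMoment_succ (m d : ℕ) :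
    stateMoment μ m (d + 1) = layerStep (brickEquiv m d) μ (stateMoment μ m d) := by
  ext v
  have hC (ω : Fin (d + 1) × Fin m → U4) :
      repl (circuitOf (gatesOf ω)) v (fun _ => allZero _) = ∑ v',
        (∏ j, repl (ω (Fin.last d, j) : Gate2) (gatePair (brickEquiv m d) j v)
          (gatePair (brickEquiv m d) j v')) *
        repl (circuitOf (gatesOf fun p : Fin d × Fin m => ω (p.1.castSucc, p.2))) v'
          (fun _ => allZero _) := by
    simp only [circuitOf_gatesOf_succ, repl_mul, repl_layerOf]
  simp only [stateMoment, layerStep, hC]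
  rw [integral_finsetSum]
  · refine Finset.sum_congr rfl fun v' _ => ?_
    rw [integral_mul_splitLast μ (fun ω => repl (circuitOf (gatesOf ω)) v' fun _ => allZero _)
      fun ω => ∏ j, repl (ω j : Gate2) (gatePair (brickEquiv m d) j v)
          (gatePair (brickEquiv m d) j v')]
    congr 1
    exact integral_fintype_prod_eq_prod (fun j (g : U4) => repl (g : Gate2)
      (gatePair (brickEquiv m d) j v) (gatePair (brickEquiv m d) j v'))
  · intro v' _
    refine Continuous.integrable_of_hasCompactSupport (.mul ?_ ?_)
      (HasCompactSupport.of_compactSpace _)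
    · exact continuous_finsetProd _ fun j _ =>
        (continuous_subtype_val.comp (continuous_apply _)).repl _ _
    · exact ((continuous_circuitOf d m).comp
        (continuous_pi fun p => continuous_apply (p.1.castSucc, p.2))).repl _ _

end Circuit

section Purity

/-- The coefficient of the pairing `b` in the gate average of the pairings `s` and `s'`. -/
def gateWeight (s s' b : Bool) : ℝ := if s = s' then if b = s then 1 else 0 else 2 / 5

theorem gateCoeff_pairing (s s' b : Bool) :
    gateCoeff (pairing s) (pairing s') b = gateWeight s s' b := by
  simp only [gateCoeff, overlap_pairing, gateWeight]
  cases s <;> cases s' <;> cases b <;> norm_num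

theorem gateWeight_nonneg (s s' b : Bool) : 0 ≤ gateWeight s s' b := by
  unfold gateWeight
  split_ifs <;> norm_num

variable {J N : Type*} [Fintype J] [Fintype N]

/-- The action of an averaged layer of gates on functions of qubit bipartitions. -/
def purityStep [DecidableEq J] (e : J ⊕ J ≃ N) (p : (N → Bool) → ℝ) (s : N → Bool) : ℝ :=
  ∑ b : J → Bool, (∏ j, gateWeight (s (e (.inl j))) (s (e (.inr j))) (b j)) * p (b ∘ gateAt e)

/-- The number of gates whose two qubits lie on different sides of a bipartition. -/
def cuts (e : J ⊕ J ≃ N) (s : N → Bool) : ℕ :=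
  Finset.card {j | s (e (.inl j)) ≠ s (e (.inr j))}

/-- The weight of a bipartition: `2` to the number of qubits on side `c`. -/
def sideDim (c : Bool) (s : N → Bool) : ℝ := ∏ i, if s i = c then 2 else 1

/-- The purity of a Haar-random state across a bipartition. -/
def haarPurity (s : N → Bool) : ℝ :=
  (sideDim true s + sideDim false s) / (2 ^ Fintype.card N + 1)

theorem sideDim_comp_gateAt (e : J ⊕ J ≃ N) (c : Bool) (b : J → Bool) :
    sideDim c (b ∘ gateAt e) = ∏ j, if b j = c then 4 else 1 := by
  rw [sideDim, prod_eq_prod_gate e]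
  refine Finset.prod_congr rfl fun j _ => ?_
  simp only [Function.comp_apply, gateAt, Equiv.symm_apply_apply, Sum.elim_inl, Sum.elim_inr, id]
  split_ifs <;> norm_num

theorem haarPurity_nonneg (s : N → Bool) : 0 ≤ haarPurity s := by
  have h (c) : 0 ≤ sideDim c s := Finset.prod_nonneg fun i _ => by split_ifs <;> norm_num
  have := h true
  have := h false
  unfold haarPurity
  positivity

theorem haarPurity_const (c : Bool) : haarPurity (fun _ : N => c) = 1 := by
  have : 1 + (2 : ℝ) ^ Fintype.card N ≠ 0 := by positivity
  cases c <;> simp [haarPurity, sideDim, add_comm, this]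

variable [DecidableEq J]

theorem purityStep_sideDim (e : J ⊕ J ≃ N) (c : Bool) (s : N → Bool) :
    purityStep e (sideDim c) s = sideDim c s := by
  simp only [purityStep, sideDim_comp_gateAt, ← Finset.prod_mul_distrib]
  rw [sideDim, prod_eq_prod_gate e]
  refine (Finset.prod_univ_sum (fun _ => Finset.univ) fun j b =>
    gateWeight (s (e (.inl j))) (s (e (.inr j))) b * if b = c then 4 else 1).symm.trans ?_
  refine Finset.prod_congr rfl fun j _ => ?_
  generalize s (e (.inl j)) = x
  generalize s (e (.inr j)) = y
  rw [Fintype.sum_bool]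
  cases c <;> cases x <;> cases y <;> norm_num [gateWeight]

theorem purityStep_haarPurity (e : J ⊕ J ≃ N) (s : N → Bool) :
    purityStep e haarPurity s = haarPurity s := by
  rw [haarPurity, ← purityStep_sideDim e, ← purityStep_sideDim e]
  simp only [purityStep, haarPurity, ← Finset.sum_add_distrib, Finset.sum_div]
  exact Finset.sum_congr rfl fun b _ => by ring

omit [Fintype N] in
theorem sum_prod_gateWeight (e : J ⊕ J ≃ N) (s : N → Bool) :
    ∑ b : J → Bool, ∏ j, gateWeight (s (e (.inl j))) (s (e (.inr j))) (b j) =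
      (4 / 5) ^ cuts e s := by
  refine (Finset.prod_univ_sum (fun _ => Finset.univ) fun j b =>
    gateWeight (s (e (.inl j))) (s (e (.inr j))) b).symm.trans ?_
  rw [cuts, ← Finset.prod_const, Finset.prod_filter]
  refine Finset.prod_congr rfl fun j _ => ?_
  generalize s (e (.inl j)) = x
  generalize s (e (.inr j)) = y
  rw [Fintype.sum_bool]
  cases x <;> cases y <;> norm_num [gateWeight]

theorem purityStep_le (e : J ⊕ J ≃ N) {p : (N → Bool) → ℝ} {ε : ℝ}
    (hp : ∀ b : J → Bool, p (b ∘ gateAt e) ≤ haarPurity (b ∘ gateAt e) + ε) (s : N → Bool) :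
    purityStep e p s ≤ haarPurity s + (4 / 5) ^ cuts e s * ε := by
  rw [← purityStep_haarPurity e, ← sum_prod_gateWeight, Finset.sum_mul]
  simp only [purityStep, ← Finset.sum_add_distrib, ← mul_add]
  exact Finset.sum_le_sum fun b _ => mul_le_mul_of_nonneg_left (hp b)
    (Finset.prod_nonneg fun j _ => gateWeight_nonneg _ _ _)

omit [Fintype N] in
theorem purityStep_const (e : J ⊕ J ≃ N) (p : (N → Bool) → ℝ) (c : Bool) :
    purityStep e p (fun _ => c) = p fun _ => c := by
  rw [purityStep, Fintype.sum_eq_single fun _ => c]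
  · simp [gateWeight, Function.comp_def]
  · intro b hb
    obtain ⟨j, hj⟩ := Function.ne_iff.mp hb
    rw [Finset.prod_eq_zero (Finset.mem_univ j) (by simp [gateWeight, hj]), zero_mul]

omit [DecidableEq J] in
theorem even_cuts (e e' : J ⊕ J ≃ N) (b : J → Bool) : Even (cuts e (b ∘ gateAt e')) := by
  rw [← neg_one_pow_eq_one_iff_even (R := ℤ) (by norm_num), cuts, ← Finset.prod_const,
    Finset.prod_filter]
  set s := b ∘ gateAt e'
  calc _ = ∏ j, (if s (e (.inl j)) then (-1 : ℤ) else 1) * if s (e (.inr j)) then -1 else 1 := by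
        refine Finset.prod_congr rfl fun j _ => ?_
        cases s (e (.inl j)) <;> cases s (e (.inr j)) <;> rfl
    _ = ∏ j, (if s (e' (.inl j)) then (-1 : ℤ) else 1) * if s (e' (.inr j)) then -1 else 1 := by
        rw [← prod_eq_prod_gate e fun i => if s i then (-1 : ℤ) else 1,
          ← prod_eq_prod_gate e' fun i => if s i then (-1 : ℤ) else 1]
    _ = 1 := Finset.prod_eq_one fun j _ => by
        simp only [s, Function.comp_apply, gateAt, Equiv.symm_apply_apply, Sum.elim_inl,
          Sum.elim_inr, id]
        cases b j <;> rfl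

/-- The average purity, across each bipartition of the ring, of the state prepared by a random
circuit of given depth. -/
def avgPurity (m : ℕ) : ℕ → (Fin (2 * m) → Bool) → ℝ
  | 0 => fun _ => 1
  | d + 1 => purityStep (brickEquiv m d) (avgPurity m d)

theorem avgPurity_const (m d : ℕ) (c : Bool) : avgPurity m d (fun _ => c) = 1 := by
  induction d with
  | zero => rfl
  | succ d ih => rw [avgPurity, purityStep_const, ih]

theorem eq_const_of_oddEquiv_of_evenEquiv {m : ℕ} (hm : 0 < m) {s : Fin (2 * m) → Bool}
    (ho : ∀ j, s (oddEquiv m (.inl j)) = s (oddEquiv m (.inr j)))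
    (he : ∀ j, s (evenEquiv m (.inl j)) = s (evenEquiv m (.inr j))) :
    s = fun _ => s ⟨0, by omega⟩ := by
  have h (i : ℕ) (hi : i < 2 * m) : s ⟨i, hi⟩ = s ⟨0, by omega⟩ := by
    induction i with
    | zero => rfl
    | succ i ih =>
      rw [← ih (by omega)]
      obtain ⟨j, rfl | rfl⟩ := i.even_or_odd'
      · exact (ho ⟨j, by omega⟩).symm
      · exact (congrArg s (Fin.ext (Nat.mod_eq_of_lt hi).symm)).trans (he ⟨j, by omega⟩).symm
  exact funext fun i => h i i.2

theorem eq_const_of_cuts_eq_zero {m : ℕ} (hm : 0 < m) (t : ℕ) (b : Fin m → Bool)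
    (h : cuts (brickEquiv m t) (b ∘ gateAt (brickEquiv m (t + 1))) = 0) :
    ∃ c, b ∘ gateAt (brickEquiv m (t + 1)) = fun _ => c := by
  set s := b ∘ gateAt (brickEquiv m (t + 1)) with hs
  have h1 (j) : s (brickEquiv m t (.inl j)) = s (brickEquiv m t (.inr j)) := by
    rw [cuts, Finset.card_eq_zero, Finset.filter_eq_empty_iff] at h
    exact not_not.mp (h (Finset.mem_univ j))
  have h2 (j) : s (brickEquiv m (t + 1) (.inl j)) = s (brickEquiv m (t + 1) (.inr j)) := by
    simp [hs, gateAt]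
  refine ⟨s ⟨0, by omega⟩, ?_⟩
  unfold brickEquiv at h1 h2
  rcases Nat.mod_two_eq_zero_or_one t with ht | ht
  · rw [if_pos ht] at h1
    rw [if_neg (by omega)] at h2
    exact eq_const_of_oddEquiv_of_evenEquiv hm h1 h2
  · rw [if_neg (by omega)] at h1
    rw [if_pos (by omega)] at h2
    exact eq_const_of_oddEquiv_of_evenEquiv hm h2 h1

theorem avgPurity_le {m : ℕ} (hm : 0 < m) (t : ℕ) (b : Fin m → Bool) :
    avgPurity m t (b ∘ gateAt (brickEquiv m t)) ≤
      haarPurity (b ∘ gateAt (brickEquiv m t)) + (16 / 25) ^ t := by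
  induction t generalizing b with
  | zero => simpa [avgPurity] using haarPurity_nonneg _
  | succ t ih =>
    by_cases h : cuts (brickEquiv m t) (b ∘ gateAt (brickEquiv m (t + 1))) = 0
    · obtain ⟨c, hc⟩ := eq_const_of_cuts_eq_zero hm t b h
      rw [hc, avgPurity_const, haarPurity_const, le_add_iff_nonneg_right]
      positivity
    · refine (purityStep_le _ ih _).trans (add_le_add_right ?_ _)
      obtain ⟨k, hk⟩ := even_cuts (brickEquiv m t) (brickEquiv m (t + 1)) b
      rw [pow_succ', show (16 / 25 : ℝ) = (4 / 5) ^ 2 by norm_num]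
      gcongr ?_ * _
      exact pow_le_pow_of_le_one (by norm_num) (by norm_num) (by omega)

theorem expect_pairing_stateMoment (μ : Measure U4) [μ.IsHaarMeasure] [IsProbabilityMeasure μ]
    (m d : ℕ) (s : Fin (2 * m) → Bool) :
    expect (fun i => pairing (s i)) (stateMoment μ m d) = avgPurity m d s := by
  induction d generalizing s with
  | zero =>
    simp only [expect, stateMoment_zero, mul_ite, mul_one, mul_zero, Finset.sum_ite_eq',
      Finset.mem_univ, if_true, avgPurity, Complex.ofReal_one]
    exact Finset.prod_eq_one fun i _ => by cases s i <;> simp [pairing, allZero]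
  | succ d ih =>
    rw [stateMoment_succ, expect_layerStep]
    simp only [gateCoeff_pairing, avgPurity, purityStep, Complex.ofReal_sum, Complex.ofReal_mul,
      Complex.ofReal_prod, ← ih]
    rfl

end Purity

section Observable

/-- The one-qubit four-replica observable of the squared expectation value of a Pauli matrix. -/
def pauliObs (k : Fin 4) (r : Fin 4 → Fin 2) : ℂ :=
  Pauli k (r 0) (r 1) * star (Pauli k (r 3) (r 2))

theorem pauliObs_zero : pauliObs 0 = pairing false := by
  ext r
  simp [pauliObs, Pauli, pairing, Matrix.one_apply, eq_comm (a := r 3)]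

theorem overlap_pauliObs_one (b : Bool) : overlap b (pauliObs 1) = if b then 2 else 0 := by
  rw [overlap, sum_fin_four]
  have h2 (x y z w : Fin 2) : (![x, y, z, w] : Fin 4 → Fin 2) 2 = z := rfl
  have h3 (x y z w : Fin 2) : (![x, y, z, w] : Fin 4 → Fin 2) 3 = w := rfl
  cases b <;> norm_num [pairing_vec, pauliObs, Pauli, Fin.sum_univ_two, h2, h3]

theorem gateCoeff_pauliObs (b : Bool) :
    gateCoeff (pauliObs 1) (pauliObs 0) b = if b then 4 / 15 else -1 / 15 := by
  rw [pauliObs_zero]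
  simp only [gateCoeff, overlap_pauliObs_one, overlap_pairing]
  cases b <;> norm_num

theorem gateCoeff_comm (φ φ' : (Fin 4 → Fin 2) → ℂ) : gateCoeff φ φ' = gateCoeff φ' φ := by
  ext b
  unfold gateCoeff
  ring

theorem normSq_zeroExp_pauliString {n : ℕ} (C : Matrix (QIdx n) (QIdx n) ℂ) (α : Fin n → Fin 4) :
    (Complex.normSq (zeroExp C (pauliString α)) : ℂ) =
      expect (fun i => pauliObs (α i)) fun v => repl C v fun _ => allZero n := by
  have h : zeroExp C (pauliString α) = ∑ x, ∑ y, star (C x (allZero n)) *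
      (∏ i, Pauli (α i) (x i) (y i)) * C y (allZero n) := by
    simp only [zeroExp, Matrix.mul_apply, Matrix.conjTranspose_apply, Finset.sum_mul, pauliString,
      Matrix.of_apply]
    exact Finset.sum_comm
  rw [← Complex.mul_conj, expect, sum_fin_four, h]
  simp only [map_sum, Finset.sum_mul]
  refine Finset.sum_congr rfl fun x _ => Finset.sum_congr rfl fun y _ => ?_
  rw [Finset.sum_comm]
  simp only [Finset.mul_sum]
  refine Finset.sum_congr rfl fun w _ => Finset.sum_congr rfl fun z _ => ?_
  simp only [repl_eq, pauliObs, Finset.prod_mul_distrib, map_mul, map_prod,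
    starRingEnd_apply]
  simp
  ring

theorem expect_pauliX_stateMoment (μ : Measure U4) [μ.IsHaarMeasure] [IsProbabilityMeasure μ]
    {m : ℕ} (d : ℕ) (i₀ : Fin (2 * m)) :
    expect (fun i => pauliObs (if i = i₀ then 1 else 0)) (stateMoment μ m (d + 1)) =
      ((4 / 15 * avgPurity m d (Function.update (fun _ => false) (gateAt (brickEquiv m d) i₀) true ∘
        gateAt (brickEquiv m d)) - 1 / 15 : ℝ) : ℂ) := by
  rw [stateMoment_succ, expect_layerStep]
  set e := brickEquiv m d
  set j₀ := gateAt e i₀ with hj₀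
  have hco (j b) : gateCoeff (pauliObs (if e (.inl j) = i₀ then 1 else 0))
      (pauliObs (if e (.inr j) = i₀ then 1 else 0)) b =
      if j = j₀ then if b then 4 / 15 else -1 / 15 else if b then 0 else 1 := by
    obtain ⟨k, rfl⟩ := e.surjective i₀
    have h0 : gateCoeff (pauliObs 0) (pauliObs 0) b = if b then 0 else 1 := by
      rw [pauliObs_zero, gateCoeff_pairing]
      cases b <;> simp [gateWeight]
    cases k <;> simp only [e.injective.eq_iff, reduceCtorEq, if_false, Sum.inl.injEq,
      Sum.inr.injEq, hj₀, gateAt, Equiv.symm_apply_apply, Sum.elim_inl, Sum.elim_inr, id] <;>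
      split_ifs with h <;>
      simp_all [gateCoeff_pauliObs, gateCoeff_comm (pauliObs 0) (pauliObs 1)]
  simp only [hco]
  rw [← Fintype.sum_of_injective (Function.update (fun _ => false) j₀)
    (Function.update_injective _ _) (fun x : Bool => (if x then 4 / 15 else -1 / 15) *
      expect (fun i => pairing (Function.update (fun _ => false) j₀ x (gateAt e i)))
        (stateMoment μ m d))]
  · simp only [fun x => expect_pairing_stateMoment μ m d fun i =>
      Function.update (fun _ => false) j₀ x (gateAt e i)]
    rw [Fintype.sum_bool]
    simp [avgPurity_const, Function.comp_def]
    ring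
  · intro b hb
    obtain ⟨j, hj, hbj⟩ : ∃ j ≠ j₀, b j = true := by
      by_contra! h
      refine hb ⟨b j₀, ?_⟩
      ext1 j
      by_cases hj : j = j₀
      · simp [hj]
      · simp [hj, h j hj]
    rw [Finset.prod_eq_zero (Finset.mem_univ j) (by simp [hj, hbj]), zero_mul]
  · intro x
    congr 1
    rw [Finset.prod_eq_single j₀ (fun j _ hj => by simp [hj]) (by simp)]
    simp

theorem integral_expect_repl (μ : Measure U4) [IsProbabilityMeasure μ] {m d : ℕ}
    (φ : Fin (2 * m) → (Fin 4 → Fin 2) → ℂ) :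
    ∫ ω : Fin d × Fin m → U4, expect φ (fun v => repl (circuitOf (gatesOf ω)) v fun _ => allZero _)
      ∂(Measure.pi fun _ => μ) = expect φ (stateMoment μ m d) := by
  simp only [expect, stateMoment]
  rw [integral_finsetSum _ fun v _ => (integrable_repl_circuitOf μ v _).const_mul _]
  simp only [integral_const_mul]

theorem haarPurity_update_comp_gateAt {J N : Type*} [Fintype J] [DecidableEq J] [Fintype N]
    (e : J ⊕ J ≃ N) (j₀ : J) :
    4 / 15 * haarPurity (Function.update (fun _ => false) j₀ true ∘ gateAt e) - 1 / 15 =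
      1 / ((2 : ℝ) ^ Fintype.card N + 1) := by
  have ht : sideDim true (Function.update (fun _ => false) j₀ true ∘ gateAt e) = 4 := by
    rw [sideDim_comp_gateAt, Finset.prod_eq_single j₀ (fun j _ hj => by simp [hj]) (by simp)]
    simp
  have hf : 4 * sideDim false (Function.update (fun _ => false) j₀ true ∘ gateAt e) =
      2 ^ Fintype.card N := by
    rw [← ht, sideDim_comp_gateAt, sideDim_comp_gateAt, ← Finset.prod_mul_distrib,
      ← Fintype.card_congr e, Fintype.card_sum, ← two_mul, pow_mul, ← Finset.card_univ,
      ← Finset.prod_const]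
    refine Finset.prod_congr rfl fun j _ => ?_
    cases Function.update (fun _ => false) j₀ true j <;> norm_num
  rw [haarPurity, ht, ← hf]
  have : (0 : ℝ) < 4 * sideDim false (Function.update (fun _ => false) j₀ true ∘ gateAt e) + 1 := by
    rw [hf]
    positivity
  field_simp
  ring

end Observable

/-- **Fast scrambling of a single-qubit error by shallow random circuits.**
For every even `n = 2m ≥ 2` and every depth `l ≥ 1`,
`E_{C ∼ RQC(n,l)} |⟨0^n| C† X₁ C |0^n⟩|² ≤ (4/15)·(4/5)^{2(l−1)} + 1/(2^n + 1)`,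
where the expectation is over the brickwork circuit of independent Haar-random `U(4)` gates
(`μ` being the Haar probability measure on `U(4)`),
and `X₁` is Pauli `X` on the first qubit. -/
theorem fast_scrambling_single_qubit_error
    (m l : ℕ) (hm : 1 ≤ m) (hl : 1 ≤ l)
    (μ : Measure U4) [μ.IsHaarMeasure] [IsProbabilityMeasure μ] :
    (∫ ω : Fin l × Fin m → U4,
        Complex.normSq (zeroExp (circuitOf (gatesOf ω)) (pauliXat ⟨0, by omega⟩))
        ∂(Measure.pi fun _ => μ))
      ≤ (4 / 15 : ℝ) * (4 / 5 : ℝ) ^ (2 * (l - 1)) + 1 / (2 ^ (2 * m) + 1) := by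
  obtain ⟨d, rfl⟩ : ∃ d, l = d + 1 := ⟨l - 1, by omega⟩
  have h := expect_pauliX_stateMoment μ d (⟨0, by omega⟩ : Fin (2 * m))
  simp only [← integral_expect_repl, ← normSq_zeroExp_pauliString] at h
  rw [integral_complex_ofReal, Complex.ofReal_inj] at h
  simp only [pauliXat, h]
  have hle := avgPurity_le hm d
    (Function.update (fun _ => false) (gateAt (brickEquiv m d) ⟨0, by omega⟩) true)
  have heq := haarPurity_update_comp_gateAt (brickEquiv m d)
    (gateAt (brickEquiv m d) ⟨0, by omega⟩)
  rw [Fintype.card_fin] at heq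
  rw [← heq, Nat.add_sub_cancel, pow_mul, show (4 / 5 : ℝ) ^ 2 = 16 / 25 by norm_num]
  linarith

end
end

section
/- Fast scrambling of 3-local errors: there exist universal constants Δ > 0 and C₀ > 0 such that for every even n ≥ 2, every depth l ≥ 1, and every nonidentity n-qubit Pauli string σ_p that acts nontrivially on at most 3 consecutive qubits of the ring, E_{C∼RQC(n,l)} |⟨0^n| C† σ_p C |0^n⟩|² ≤ C₀ · e^{−Δ l} + 1/(2^n + 1). -/
open MeasureTheory Matrix

noncomputable section

namespace Scrambling

open Finset

variable {m : ℕ}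

/-- Distributivity of a product over sums, for sums over a function type. -/
lemma sum_prod_eq_prod_sum {ι κ R : Type*} [Fintype ι] [DecidableEq ι] [Fintype κ]
    [CommSemiring R] (f : ι → κ → R) :
    ∑ a : ι → κ, ∏ j, f j (a j) = ∏ j, ∑ z, f j z := by
  rw [Finset.prod_univ_sum, Fintype.piFinset_univ]

/-! ### The dual process of domains

A second moment of a brickwork circuit is an average over random sets `a` of gates of the current
layer (`a j = true` when gate `j` belongs to the set). A gate of the next layer touches two gates:
it copies their common value if they agree and otherwise enters the set with probability `1/5`. -/

/-- The law of a single gate whose value is not forced. -/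
def startWeight (z : Bool) : ℝ := if z then 1 / 5 else 4 / 5

/-- The transition law of one gate given the values of the two gates it touches. -/
def merge (x y z : Bool) : ℝ := if x = y then (if z = x then 1 else 0) else startWeight z

lemma startWeight_nonneg (z : Bool) : 0 ≤ startWeight z := by
  cases z <;> norm_num [startWeight]

lemma merge_nonneg (x y z : Bool) : 0 ≤ merge x y z := by
  cases x <;> cases y <;> cases z <;> norm_num [merge, startWeight]

/-- The first gate of layer `t - 1` touched by gate `j` of layer `t` is gate `shift t j`; the second
one is its successor on the ring. -/
def shift (m t : ℕ) : Equiv.Perm (Fin m) := if t % 2 = 0 then (finRotate m).symm else 1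

/-- The transition weight of the dual process into layer `t`. -/
def transition (t : ℕ) (a a' : Fin m → Bool) : ℝ :=
  ∏ j, merge (a (shift m t j)) (a (finRotate m (shift m t j))) (a' j)

lemma transition_nonneg (t : ℕ) (a a' : Fin m → Bool) : 0 ≤ transition t a a' :=
  prod_nonneg fun _ _ => merge_nonneg _ _ _

/-- The law of the dual process at layer `d`. -/
def domainLaw (m : ℕ) : ℕ → (Fin m → Bool) → ℝ
  | 0, a => ∏ j, startWeight (a j)
  | d + 1, a' => ∑ a, domainLaw m d a * transition (d + 1) a a'

lemma domainLaw_nonneg (d : ℕ) (a : Fin m → Bool) : 0 ≤ domainLaw m d a := by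
  induction d generalizing a with
  | zero => exact prod_nonneg fun _ _ => startWeight_nonneg _
  | succ d ih => exact sum_nonneg fun b _ => mul_nonneg (ih b) (transition_nonneg _ _ _)

/-- The expectation of `h` under the dual process at layer `d`. -/
def mean (d : ℕ) (h : (Fin m → Bool) → ℝ) : ℝ := ∑ a, domainLaw m d a * h a

lemma mean_succ (d : ℕ) (h : (Fin m → Bool) → ℝ) :
    mean (d + 1) h = mean d fun a => ∑ a', transition (d + 1) a a' * h a' := by
  simp only [mean, domainLaw, sum_mul, mul_sum]
  rw [sum_comm]
  exact sum_congr rfl fun _ _ => sum_congr rfl fun _ _ => by ring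

lemma mean_mono (d : ℕ) {h h' : (Fin m → Bool) → ℝ} (hh : ∀ a, h a ≤ h' a) :
    mean d h ≤ mean d h' :=
  sum_le_sum fun a _ => mul_le_mul_of_nonneg_left (hh a) (domainLaw_nonneg d a)

lemma mean_const_mul (d : ℕ) (c : ℝ) (h : (Fin m → Bool) → ℝ) :
    mean d (fun a => c * h a) = c * mean d h := by
  simp only [mean, mul_sum]
  exact sum_congr rfl fun _ _ => by ring

lemma mean_add (d : ℕ) (h h' : (Fin m → Bool) → ℝ) :
    mean d (fun a => h a + h' a) = mean d h + mean d h' := by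
  simp only [mean, mul_add, sum_add_distrib]

lemma mean_zero_prod (f : Fin m → Bool → ℝ) :
    mean 0 (fun a => ∏ j, f j (a j)) = ∏ j, (1 / 5 * f j true + 4 / 5 * f j false) := by
  simp only [mean, domainLaw, ← prod_mul_distrib]
  rw [sum_prod_eq_prod_sum fun j z => startWeight z * f j z]
  simp [startWeight]

lemma sum_transition_prod (t : ℕ) (a : Fin m → Bool) (f : Fin m → Bool → ℝ) :
    ∑ a', transition t a a' * ∏ j, f j (a' j) =
      ∏ j, ∑ z, merge (a (shift m t j)) (a (finRotate m (shift m t j))) z * f j z := by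
  simp only [transition, ← prod_mul_distrib]
  exact sum_prod_eq_prod_sum fun j z =>
    merge (a (shift m t j)) (a (finRotate m (shift m t j))) z * f j z

lemma mean_one (d : ℕ) : mean d (fun _ : Fin m → Bool => (1 : ℝ)) = 1 := by
  induction d with
  | zero =>
    have h := mean_zero_prod (m := m) fun _ _ => 1
    norm_num at h
    exact h
  | succ d ih =>
    rw [mean_succ]
    refine Eq.trans ?_ ih
    congr 1
    funext a
    have h := sum_transition_prod (d + 1) a fun _ _ => 1
    simp only [prod_const_one] at h
    rw [h]
    refine prod_eq_one fun j _ => ?_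
    rw [Fintype.sum_bool]
    cases a (shift m (d + 1) j) <;> cases a (finRotate m (shift m (d + 1) j)) <;>
      norm_num [merge, startWeight]

/-- `16 ^ |a|` is a martingale of the dual process. -/
lemma mean_prod_sixteen (d : ℕ) :
    mean d (fun a : Fin m → Bool => ∏ j, if a j then (16 : ℝ) else 1) = 4 ^ m := by
  induction d with
  | zero =>
    rw [mean_zero_prod fun _ z => if z then (16 : ℝ) else 1]
    norm_num
  | succ d ih =>
    rw [mean_succ, ← ih]
    congr 1
    funext a
    rw [sum_transition_prod (d + 1) a fun _ z => if z then (16 : ℝ) else 1]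
    have h : ∀ x y : Bool, ∑ z, merge x y z * (if z then (16 : ℝ) else 1) =
        (if x then 4 else 1) * (if y then 4 else 1) := by
      intro x y
      rw [Fintype.sum_bool]
      cases x <;> cases y <;> norm_num [merge, startWeight]
    simp only [h, prod_mul_distrib]
    rw [Equiv.prod_comp (shift m (d + 1)) fun i => if a i then (4 : ℝ) else 1,
      Equiv.prod_comp (shift m (d + 1)) fun i => if a (finRotate m i) then (4 : ℝ) else 1,
      Equiv.prod_comp (finRotate m) fun i => if a i then (4 : ℝ) else 1, ← prod_mul_distrib]
    refine prod_congr rfl fun j _ => ?_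
    cases a j <;> norm_num

/-- The probability that the dual process has filled the ring. -/
lemma mean_full_le (hm : 1 ≤ m) (d : ℕ) :
    mean d (fun a : Fin m → Bool => if ∀ j, a j = true then (1 : ℝ) else 0) ≤
      1 / (4 ^ m + 1) := by
  have h4 : (1 : ℝ) < 4 ^ m := one_lt_pow₀ (by norm_num) (by omega)
  have h16 : (16 : ℝ) ^ m = 4 ^ m * 4 ^ m := by rw [← mul_pow]; norm_num
  have key : mean d (fun a : Fin m → Bool =>
      ((4 : ℝ) ^ m * 4 ^ m - 1) * (if ∀ j, a j = true then (1 : ℝ) else 0) + 1) ≤ 4 ^ m := by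
    refine (mean_mono d fun a => ?_).trans (mean_prod_sixteen d).le
    split_ifs with h
    · simp [h, h16]
    · have : (1 : ℝ) ≤ ∏ j, if a j then (16 : ℝ) else 1 :=
        Finset.one_le_prod fun j => by split_ifs <;> norm_num
      linarith
  rw [mean_add, mean_const_mul, mean_one] at key
  rw [le_div_iff₀ (by positivity)]
  nlinarith

/-! ### Exponential decay away from the absorbing states -/

lemma forall_of_imp_finRotate {p : Fin m → Prop} (hp : ∀ j, p j → p (finRotate m j)) {j₀ : Fin m}
    (h₀ : p j₀) (i : Fin m) : p i := by
  obtain _ | n := m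
  · exact i.elim0
  · have h : ∀ x : Fin (n + 1), p (j₀ + x) := by
      intro x
      induction x using Fin.induction with
      | zero => simpa using h₀
      | succ x ih =>
        have := hp _ ih
        rwa [finRotate_apply, add_assoc, Fin.coeSucc_eq_succ] at this
    simpa using h (i - j₀)

/-- The expected weight of one gate when members of the set have weight `9 / 4`. -/
def gateWeight (x y : Bool) : ℝ := ∑ z, merge x y z * (if z then 9 / 4 else 1)

lemma gateWeight_eq (x y : Bool) : gateWeight x y =
    (if x then 3 / 2 else 1) * (if y then 3 / 2 else 1) * (if x = y then 1 else 5 / 6) := by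
  rw [gateWeight, Fintype.sum_bool]
  cases x <;> cases y <;> norm_num [merge, startWeight]

lemma one_le_gateWeight (x y : Bool) : 1 ≤ gateWeight x y := by
  rw [gateWeight_eq]
  cases x <;> cases y <;> norm_num

/-- A nontrivial set of gates on the ring has at least two boundary points, each of which costs a
factor `5 / 6`. -/
lemma prod_gateWeight_le (c : Fin m → Bool) {i₀ i₁ : Fin m} (h₀ : c i₀ = false)
    (h₁ : c i₁ = true) :
    ∏ j, gateWeight (c j) (c (finRotate m j)) ≤ 25 / 36 * ∏ j, if c j then (9 / 4 : ℝ) else 1 := by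
  obtain ⟨u, hu, hu'⟩ : ∃ j, c j = true ∧ c (finRotate m j) ≠ true := by
    by_contra! h
    have := forall_of_imp_finRotate (p := fun j => c j = true) h h₁ i₀
    simp [h₀] at this
  obtain ⟨v, hv, hv'⟩ : ∃ j, c j = false ∧ c (finRotate m j) ≠ false := by
    by_contra! h
    have := forall_of_imp_finRotate (p := fun j => c j = false) h h₀ i₁
    simp [h₁] at this
  have huv : u ≠ v := by
    rintro rfl
    simp [hu] at hv
  simp only [gateWeight_eq, prod_mul_distrib]
  rw [Equiv.prod_comp (finRotate m) fun i => if c i then (3 / 2 : ℝ) else 1, ← prod_mul_distrib]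
  have hsq : ∏ j, ((if c j then (3 / 2 : ℝ) else 1) * if c j then 3 / 2 else 1) =
      ∏ j, if c j then (9 / 4 : ℝ) else 1 :=
    prod_congr rfl fun j _ => by split_ifs <;> norm_num
  have hle : ∏ j, (if c j = c (finRotate m j) then (1 : ℝ) else 5 / 6) ≤ 25 / 36 := by
    calc ∏ j, (if c j = c (finRotate m j) then (1 : ℝ) else 5 / 6)
        ≤ ∏ j ∈ {u, v}, (if c j = c (finRotate m j) then (1 : ℝ) else 5 / 6) := by
          refine prod_le_prod_of_subset_of_le_one (subset_univ _) ?_ ?_ <;>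
            · intros
              split_ifs <;> norm_num
      _ ≤ 25 / 36 := by
          rw [prod_pair huv, if_neg, if_neg]
          · norm_num
          · rw [hv]; exact fun h => hv' h.symm
          · rw [hu]; exact fun h => hu' h.symm
  rw [hsq, mul_comm]
  exact mul_le_mul_of_nonneg_right hle (prod_nonneg fun j _ => by split_ifs <;> norm_num)

open Classical in
/-- The weight `(9 / 4) ^ |a ∩ B|`, restricted to sets `a` that meet `B` and do not fill the
ring. -/
def windowWeight (B : Finset (Fin m)) (a : Fin m → Bool) : ℝ :=
  if (∃ j ∈ B, a j = true) ∧ ∃ j, a j = false then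
    ∏ j, if j ∈ B ∧ a j = true then (9 / 4 : ℝ) else 1
  else 0

lemma windowWeight_nonneg (B : Finset (Fin m)) (a : Fin m → Bool) : 0 ≤ windowWeight B a := by
  unfold windowWeight
  split_ifs
  · exact prod_nonneg fun j _ => by split_ifs <;> norm_num
  · rfl

lemma sum_transition_windowWeight_le (t : ℕ) {B B' : Finset (Fin m)}
    (hB : ∀ j ∈ B', shift m t j ∈ B ∧ finRotate m (shift m t j) ∈ B) (a : Fin m → Bool) :
    ∑ a', transition t a a' * windowWeight B' a' ≤ 25 / 36 * windowWeight B a := by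
  classical
  by_cases ha : (∃ j ∈ B, a j = true) ∧ ∃ j, a j = false
  · obtain ⟨⟨i₁, hi₁, hai₁⟩, i₀, hai₀⟩ := ha
    set c : Fin m → Bool := fun j => decide (j ∈ B ∧ a j = true) with hc
    have hcB : ∀ j ∈ B, c j = a j := fun j hj => by simp [hc, hj]
    calc ∑ a', transition t a a' * windowWeight B' a'
        ≤ ∑ a', transition t a a' * ∏ j, (if j ∈ B' ∧ a' j = true then (9 / 4 : ℝ) else 1) := by
          refine sum_le_sum fun a' _ => mul_le_mul_of_nonneg_left ?_ (transition_nonneg _ _ _)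
          unfold windowWeight
          split_ifs
          · exact le_rfl
          · exact prod_nonneg fun j _ => by split_ifs <;> norm_num
      _ = ∏ j, ∑ z, merge (a (shift m t j)) (a (finRotate m (shift m t j))) z *
            (if j ∈ B' ∧ z = true then (9 / 4 : ℝ) else 1) :=
          sum_transition_prod t a fun j z => if j ∈ B' ∧ z = true then (9 / 4 : ℝ) else 1
      _ ≤ ∏ j, gateWeight (c (shift m t j)) (c (finRotate m (shift m t j))) := by
          refine prod_le_prod (fun j _ => sum_nonneg fun z _ => mul_nonneg (merge_nonneg _ _ _)
            (by split_ifs <;> norm_num)) fun j _ => ?_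
          by_cases hj : j ∈ B'
          · rw [hcB _ (hB j hj).1, hcB _ (hB j hj).2, gateWeight]
            simp [hj]
          · refine le_trans (le_of_eq ?_) (one_le_gateWeight _ _)
            simp only [hj, false_and, if_false, Fintype.sum_bool]
            cases a (shift m t j) <;> cases a (finRotate m (shift m t j)) <;>
              norm_num [merge, startWeight]
      _ = ∏ j, gateWeight (c j) (c (finRotate m j)) :=
          Equiv.prod_comp (shift m t) fun j => gateWeight (c j) (c (finRotate m j))
      _ ≤ 25 / 36 * ∏ j, (if c j then (9 / 4 : ℝ) else 1) :=
          prod_gateWeight_le c (i₀ := i₀) (i₁ := i₁) (by simp [hc, hai₀]) (by simp [hc, hi₁, hai₁])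
      _ = 25 / 36 * windowWeight B a := by
          rw [windowWeight, if_pos ⟨⟨i₁, hi₁, hai₁⟩, i₀, hai₀⟩]
          simp [hc]
  · rw [windowWeight, if_neg ha, mul_zero]
    refine sum_nonpos fun a' _ => le_of_eq ?_
    by_contra hne
    obtain ⟨hK, hw⟩ := mul_ne_zero_iff.1 hne
    have hstep : ∀ j, merge (a (shift m t j)) (a (finRotate m (shift m t j))) (a' j) ≠ 0 :=
      fun j => prod_ne_zero_iff.1 hK j (mem_univ j)
    have ha' : (∃ j ∈ B', a' j = true) ∧ ∃ j, a' j = false := by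
      by_contra h
      exact hw (by rw [windowWeight, if_neg h])
    refine ha ?_
    obtain ⟨⟨i, hi, hai⟩, k, hak⟩ := ha'
    constructor
    · by_contra! h
      have h₁ := h _ (hB i hi).1
      have h₂ := h _ (hB i hi).2
      have := hstep i
      simp only [Bool.not_eq_true] at h₁ h₂
      rw [h₁, h₂, hai] at this
      simp [merge] at this
    · by_contra! h
      have h₁ := h (shift m t k)
      have h₂ := h (finRotate m (shift m t k))
      have := hstep k
      simp only [ne_eq, Bool.not_eq_false] at h₁ h₂
      rw [h₁, h₂, hak] at this
      simp [merge] at this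

/-- The `w` consecutive gates starting at `c`. -/
def window (c : Fin m) (w : ℕ) : Finset (Fin m) :=
  (range w).image fun x => (finRotate m ^ x) c

lemma shift_mem_window (t : ℕ) (c : Fin m) (w : ℕ) {j : Fin m} (hj : j ∈ window c w) :
    shift m t j ∈ window (shift m t c) (w + 1) ∧
      finRotate m (shift m t j) ∈ window (shift m t c) (w + 1) := by
  obtain ⟨x, hx, rfl⟩ := mem_image.1 hj
  have hcomm : Commute (shift m t) (finRotate m ^ x) := by
    refine Commute.pow_right ?_ x
    unfold shift
    split_ifs
    · exact (Commute.refl (finRotate m)).inv_left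
    · exact Commute.one_left _
  have h : shift m t ((finRotate m ^ x) c) = (finRotate m ^ x) (shift m t c) :=
    Equiv.congr_fun hcomm.eq c
  have hx := mem_range.1 hx
  rw [h]
  exact ⟨mem_image.2 ⟨x, mem_range.2 (by omega), rfl⟩,
    mem_image.2 ⟨x + 1, mem_range.2 (by omega), by rw [pow_succ']; rfl⟩⟩

lemma mean_windowWeight_le (d : ℕ) (c : Fin m) (w : ℕ) :
    mean d (windowWeight (window c w)) ≤ (25 / 36) ^ d * (5 / 4) ^ (w + d) := by
  induction d generalizing c w with
  | zero =>
    classical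
    calc mean 0 (windowWeight (window c w))
        ≤ mean 0 (fun a => ∏ j, if j ∈ window c w ∧ a j = true then (9 / 4 : ℝ) else 1) := by
          refine mean_mono 0 fun a => ?_
          unfold windowWeight
          split_ifs
          · exact le_rfl
          · exact prod_nonneg fun j _ => by split_ifs <;> norm_num
      _ = ∏ j, (if j ∈ window c w then (5 / 4 : ℝ) else 1) := by
          rw [mean_zero_prod fun j z => if j ∈ window c w ∧ z = true then (9 / 4 : ℝ) else 1]
          exact prod_congr rfl fun j _ => by by_cases h : j ∈ window c w <;> norm_num [h]
      _ = (5 / 4) ^ (window c w).card := by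
          rw [prod_ite_mem, univ_inter, prod_const]
      _ ≤ (25 / 36) ^ 0 * (5 / 4) ^ (w + 0) := by
          rw [pow_zero, one_mul, add_zero]
          refine pow_le_pow_right₀ (by norm_num) ?_
          exact card_image_le.trans (card_range w).le
  | succ d ih =>
    rw [mean_succ]
    calc mean d (fun a => ∑ a', transition (d + 1) a a' * windowWeight (window c w) a')
        ≤ mean d (fun a => 25 / 36 * windowWeight (window (shift m (d + 1) c) (w + 1)) a) :=
          mean_mono d (sum_transition_windowWeight_le (d + 1)
            fun j hj => shift_mem_window (d + 1) c w hj)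
      _ = 25 / 36 * mean d (windowWeight (window (shift m (d + 1) c) (w + 1))) :=
          mean_const_mul _ _ _
      _ ≤ 25 / 36 * ((25 / 36) ^ d * (5 / 4) ^ (w + 1 + d)) :=
          mul_le_mul_of_nonneg_left (ih _ _) (by norm_num)
      _ = (25 / 36) ^ (d + 1) * (5 / 4) ^ (w + (d + 1)) := by
          rw [add_assoc w 1 d, add_comm 1 d]; ring

/-- The probability that the dual process contains a given gate is its limit, up to an
exponentially small error. -/
lemma mean_mem_le (d : ℕ) (c : Fin m) :
    mean d (fun a => if a c = true then (1 : ℝ) else 0) ≤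
      (25 / 36) ^ d * (5 / 4) ^ (d + 1) + 1 / (4 ^ m + 1) := by
  have hm : 1 ≤ m := by have := c.2; omega
  calc mean d (fun a => if a c = true then (1 : ℝ) else 0)
      ≤ mean d (fun a => windowWeight (window c 1) a +
          if ∀ j, a j = true then (1 : ℝ) else 0) := by
        refine mean_mono d fun a => ?_
        by_cases hfull : ∀ j, a j = true
        · simp only [hfull, if_true, implies_true]
          linarith [windowWeight_nonneg (window c 1) a]
        · rw [if_neg hfull, add_zero]
          split_ifs with hc
          · rw [windowWeight, if_pos]
            · exact one_le_prod fun j => by split_ifs <;> norm_num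
            · push Not at hfull
              exact ⟨⟨c, by simp [window], hc⟩, by simpa using hfull⟩
          · exact windowWeight_nonneg _ _
    _ = mean d (windowWeight (window c 1)) +
          mean d (fun a => if ∀ j, a j = true then (1 : ℝ) else 0) := mean_add _ _ _
    _ ≤ _ := by
        refine add_le_add ?_ (mean_full_le hm d)
        have := mean_windowWeight_le d c 1
        rwa [add_comm 1 d] at this

/-! ### The sites of a layer -/

/-- The first qubit acted on by gate `j` of layer `t`. -/
def leftSite (t : ℕ) (j : Fin m) : Fin (2 * m) :=
  if t % 2 = 0 then ⟨2 * j.1, by have := j.2; omega⟩ else ⟨2 * j.1 + 1, by have := j.2; omega⟩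

/-- The second qubit acted on by gate `j` of layer `t`. -/
def rightSite (t : ℕ) (j : Fin m) : Fin (2 * m) :=
  if t % 2 = 0 then ⟨2 * j.1 + 1, by have := j.2; omega⟩
  else ⟨(2 * j.1 + 2) % (2 * m), Nat.mod_lt _ (by have := j.2; omega)⟩

lemma two_mul_finRotate (j : Fin m) : 2 * (finRotate m j).1 = (2 * j.1 + 2) % (2 * m) := by
  obtain _ | n := m
  · exact j.elim0
  · rw [finRotate_apply, Fin.val_add, ← Nat.mul_mod_mul_left, mul_add]
    obtain _ | n := n
    · simp
    · rw [Fin.val_one]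

lemma leftSite_succ (t : ℕ) (j : Fin m) :
    leftSite (t + 1) j = rightSite t (shift m (t + 1) j) := by
  unfold leftSite rightSite shift
  by_cases h : t % 2 = 0
  · have h' : ¬(t + 1) % 2 = 0 := by omega
    simp [h, h']
  · have h' : (t + 1) % 2 = 0 := by omega
    simp only [h, h', if_true, if_false, Fin.mk.injEq]
    rw [← two_mul_finRotate, Equiv.apply_symm_apply]

lemma rightSite_succ (t : ℕ) (j : Fin m) :
    rightSite (t + 1) j = leftSite t (finRotate m (shift m (t + 1) j)) := by
  unfold leftSite rightSite shift
  by_cases h : t % 2 = 0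
  · have h' : ¬(t + 1) % 2 = 0 := by omega
    simp only [h, h', if_true, if_false, Fin.mk.injEq, Equiv.Perm.coe_one, id]
    rw [two_mul_finRotate]
  · have h' : (t + 1) % 2 = 0 := by omega
    simp only [h, h', if_true, if_false, Equiv.apply_symm_apply]

lemma site_bijective (m t : ℕ) :
    Function.Bijective (Sum.elim (leftSite t) (rightSite t) : Fin m ⊕ Fin m → Fin (2 * m)) := by
  induction t with
  | zero =>
    refine (Fintype.bijective_iff_injective_and_card _).2 ⟨?_, by simp [two_mul]⟩
    rintro (⟨i, hi⟩ | ⟨i, hi⟩) (⟨j, hj⟩ | ⟨j, hj⟩) h <;>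
      simp [leftSite, rightSite] at h ⊢ <;> omega
  | succ t ih =>
    let e : Fin m ⊕ Fin m ≃ Fin m ⊕ Fin m :=
      (Equiv.sumCongr (shift m (t + 1)) ((shift m (t + 1)).trans (finRotate m))).trans
        (Equiv.sumComm _ _)
    have h : (Sum.elim (leftSite (t + 1)) (rightSite (t + 1)) : Fin m ⊕ Fin m → Fin (2 * m)) =
        Sum.elim (leftSite t) (rightSite t) ∘ e := by
      funext x
      obtain j | j := x
      · simp [e, leftSite_succ]
      · simpa [e] using rightSite_succ t j
    rw [h]
    exact ih.comp e.bijective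

/-- The qubits, as the qubits acted on by the gates of layer `t`. -/
def siteEquiv (m t : ℕ) : Fin m ⊕ Fin m ≃ Fin (2 * m) := Equiv.ofBijective _ (site_bijective m t)

lemma prod_site {R : Type*} [CommMonoid R] (t : ℕ) (f : Fin (2 * m) → R) :
    ∏ i, f i = ∏ j, f (leftSite t j) * f (rightSite t j) := by
  rw [← Equiv.prod_comp (siteEquiv m t), Fintype.prod_sum_type, ← prod_mul_distrib]
  rfl

/-- Labels of qubits, grouped according to the gates of layer `t`. -/
def split (t : ℕ) {X : Type*} : (Fin (2 * m) → X) ≃ (Fin m → X × X) :=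
  ((Equiv.arrowCongr (siteEquiv m t).symm (Equiv.refl X)).trans
    (Equiv.sumArrowEquivProdArrow _ _ _)).trans (Equiv.arrowProdEquivProdArrow _ _ _).symm

lemma split_apply (t : ℕ) {X : Type*} (x : Fin (2 * m) → X) (j : Fin m) :
    split t x j = (x (leftSite t j), x (rightSite t j)) := rfl

/-! ### The Markov chain of Pauli strings -/

/-- The second moment of the coefficient at `c` of a Haar-random conjugate of the Pauli `A`. -/
def pairWeight (A c : Fin 4 × Fin 4) : ℝ :=
  if A = 0 then (if c = 0 then 1 else 0) else (if c = 0 then 0 else 1 / 15)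

/-- The squared expectation of a Pauli matrix in the state `|0⟩`. -/
def zeroWeight (b : Fin 4) : ℝ := if b = 0 ∨ b = 3 then 1 else 0

/-- The indicator that `b` is trivial if `z = false`. -/
def keep (z : Bool) (b : Fin 4) : ℝ := if z = true ∨ b = 0 then 1 else 0

lemma keep_mul_keep (z : Bool) (A : Fin 4 × Fin 4) :
    keep z A.1 * keep z A.2 = if z = true ∨ A = 0 then 1 else 0 := by
  cases z <;> simp [keep, Prod.ext_iff, ← ite_and, and_comm]

lemma sum_pairWeight_zeroWeight (A : Fin 4 × Fin 4) :
    ∑ c, pairWeight A c * (zeroWeight c.1 * zeroWeight c.2) =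
      ∑ z, startWeight z * (keep z A.1 * keep z A.2) := by
  simp only [keep_mul_keep]
  by_cases hA : A = 0 <;>
    simp [hA, pairWeight, zeroWeight, startWeight, Fintype.sum_prod_type, Fin.sum_univ_four,
      Prod.ext_iff] <;> norm_num

lemma sum_pairWeight_keep (A : Fin 4 × Fin 4) (x y : Bool) :
    ∑ c, pairWeight A c * (keep x c.1 * keep y c.2) =
      ∑ z, merge x y z * (keep z A.1 * keep z A.2) := by
  simp only [keep_mul_keep, Fintype.sum_prod_type, Fin.sum_univ_four]
  by_cases hA : A = 0 <;> cases x <;> cases y <;>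
    simp [hA, pairWeight, keep, merge, startWeight, Prod.ext_iff] <;> norm_num

/-- The second moment of a circuit with `d` layers at the Pauli string `α`. -/
def collision (m : ℕ) : ℕ → (Fin (2 * m) → Fin 4) → ℝ
  | 0, α => ∏ i, zeroWeight (α i)
  | d + 1, α => ∑ β : Fin m → Fin 4 × Fin 4,
      (∏ j, pairWeight (split d α j) (β j)) * collision m d ((split d).symm β)

lemma prod_keep_succ (t : ℕ) (a : Fin m → Bool) (β : Fin (2 * m) → Fin 4) :
    ∏ j, keep (a j) (β (leftSite t j)) * keep (a j) (β (rightSite t j)) =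
      ∏ j, keep (a (shift m (t + 1) j)) (β (leftSite (t + 1) j)) *
        keep (a (finRotate m (shift m (t + 1) j))) (β (rightSite (t + 1) j)) := by
  simp only [leftSite_succ, rightSite_succ, prod_mul_distrib]
  rw [Equiv.prod_comp (shift m (t + 1)) fun j => keep (a j) (β (rightSite t j)),
    Equiv.prod_comp (shift m (t + 1)) fun j =>
      keep (a (finRotate m j)) (β (leftSite t (finRotate m j))),
    Equiv.prod_comp (finRotate m) fun j => keep (a j) (β (leftSite t j)), mul_comm]

lemma apply_split_symm (t : ℕ) {X : Type*} (β : Fin m → X × X) (j : Fin m) :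
    (split t).symm β (leftSite t j) = (β j).1 ∧ (split t).symm β (rightSite t j) = (β j).2 := by
  have h := split_apply t ((split t).symm β) j
  rw [Equiv.apply_symm_apply] at h
  rw [h]
  exact ⟨rfl, rfl⟩

/-- The second moment at `α` is the probability that the dual process covers `α`. -/
lemma collision_succ_eq_mean (d : ℕ) (α : Fin (2 * m) → Fin 4) :
    collision m (d + 1) α =
      mean d fun a => ∏ j, keep (a j) (α (leftSite d j)) * keep (a j) (α (rightSite d j)) := by
  induction d generalizing α with
  | zero =>
    rw [mean_zero_prod fun j z => keep z (α (leftSite 0 j)) * keep z (α (rightSite 0 j))]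
    simp only [collision, prod_site 0 fun i => zeroWeight _, apply_split_symm, ← prod_mul_distrib]
    rw [sum_prod_eq_prod_sum fun j c =>
      pairWeight (split 0 α j) c * (zeroWeight c.1 * zeroWeight c.2)]
    refine prod_congr rfl fun j _ => ?_
    rw [sum_pairWeight_zeroWeight, Fintype.sum_bool]
    simp [startWeight, split_apply]
  | succ d ih =>
    rw [collision, mean_succ]
    simp only [ih, mean, mul_sum]
    rw [sum_comm]
    refine sum_congr rfl fun a _ => ?_
    rw [← mul_sum]
    simp only [mul_left_comm _ (domainLaw m d a)]
    rw [← mul_sum]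
    congr 1
    simp only [prod_keep_succ d, apply_split_symm, ← prod_mul_distrib]
    rw [sum_prod_eq_prod_sum fun j c => pairWeight (split (d + 1) α j) c *
      (keep (a (shift m (d + 1) j)) c.1 * keep (a (finRotate m (shift m (d + 1) j))) c.2),
      sum_transition_prod (d + 1) a fun j z =>
        keep z (α (leftSite (d + 1) j)) * keep z (α (rightSite (d + 1) j))]
    exact prod_congr rfl fun j _ => sum_pairWeight_keep _ _ _

lemma keep_nonneg (z : Bool) (b : Fin 4) : 0 ≤ keep z b := by
  unfold keep; split_ifs <;> norm_num

lemma keep_le_one (z : Bool) (b : Fin 4) : keep z b ≤ 1 := by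
  unfold keep; split_ifs <;> norm_num

lemma collision_succ_le (d : ℕ) {α : Fin (2 * m) → Fin 4} (hα : α ≠ fun _ => 0) :
    collision m (d + 1) α ≤ (25 / 36) ^ d * (5 / 4) ^ (d + 1) + 1 / (4 ^ m + 1) := by
  obtain ⟨i, hi⟩ := Function.ne_iff.1 hα
  obtain ⟨c, hc⟩ : ∃ c : Fin m, i = leftSite d c ∨ i = rightSite d c := by
    obtain ⟨c | c, hc⟩ := (site_bijective m d).2 i
    · exact ⟨c, Or.inl hc.symm⟩
    · exact ⟨c, Or.inr hc.symm⟩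
  rw [collision_succ_eq_mean]
  refine (mean_mono d fun a => ?_).trans (mean_mem_le d c)
  split_ifs with ha
  · exact prod_le_one (fun j _ => mul_nonneg (keep_nonneg _ _) (keep_nonneg _ _))
      fun j _ => mul_le_one₀ (keep_le_one _ _) (keep_nonneg _ _) (keep_le_one _ _)
  · refine (prod_eq_zero (mem_univ c) ?_).le
    rw [mul_eq_zero]
    obtain rfl | rfl := hc
    · exact Or.inl (if_neg (by simp [ha, hi]))
    · exact Or.inr (if_neg (by simp [ha, hi]))

/-! ### Second moments of a Haar-random two-qubit gate -/

/-- The two-qubit Pauli matrix with label `c`. -/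
def pairPauli (c : Fin 4 × Fin 4) : Gate2 := kroneckerMap (· * ·) (Pauli c.1) (Pauli c.2)

lemma sum_pauli_mul_pauli (u v x y : Fin 2) :
    ∑ a, Pauli a u v * Pauli a x y = if u = y ∧ v = x then 2 else 0 := by
  fin_cases u <;> fin_cases v <;> fin_cases x <;> fin_cases y <;>
    simp [Fin.sum_univ_four, Pauli] <;> norm_num

lemma sum_pairPauli_mul_pairPauli (u v x y : Fin 2 × Fin 2) :
    ∑ c, pairPauli c u v * pairPauli c x y = if u = y ∧ v = x then 4 else 0 := by
  have h : ∑ c, pairPauli c u v * pairPauli c x y =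
      (∑ a, Pauli a u.1 v.1 * Pauli a x.1 y.1) * ∑ b, Pauli b u.2 v.2 * Pauli b x.2 y.2 := by
    rw [sum_mul_sum, Fintype.sum_prod_type]
    refine sum_congr rfl fun a _ => sum_congr rfl fun b _ => ?_
    simp only [pairPauli, kroneckerMap_apply]
    ring
  rw [h, sum_pauli_mul_pauli, sum_pauli_mul_pauli]
  simp only [Prod.ext_iff]
  split_ifs <;> first | (exfalso; tauto) | norm_num

/-- The coefficient of `M` at the Pauli matrix with label `c`. -/
def coeff (c : Fin 4 × Fin 4) (M : Gate2) : ℂ := 1 / 4 * trace (pairPauli c * M)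

lemma sum_coeff_smul (M : Gate2) : ∑ c, coeff c M • pairPauli c = M := by
  ext x y
  simp only [Matrix.sum_apply, Matrix.smul_apply, smul_eq_mul, coeff, trace, diag_apply, mul_apply,
    mul_sum, sum_mul]
  rw [sum_comm]
  have h : ∀ u v, ∑ c, 1 / 4 * (pairPauli c u v * M v u) * pairPauli c x y =
      if u = y ∧ v = x then M v u else 0 := by
    intro u v
    calc ∑ c, 1 / 4 * (pairPauli c u v * M v u) * pairPauli c x y
        = 1 / 4 * M v u * ∑ c, pairPauli c u v * pairPauli c x y := by
          rw [mul_sum]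
          exact sum_congr rfl fun _ _ => by ring
      _ = _ := by
          rw [sum_pairPauli_mul_pairPauli]
          split_ifs <;> ring
  rw [Finset.sum_congr rfl fun u _ => (sum_comm.trans (sum_congr rfl fun v _ => h u v))]
  simp [ite_and]

lemma conjTranspose_pauli (a : Fin 4) : (Pauli a)ᴴ = Pauli a := by
  ext i j
  fin_cases a <;> fin_cases i <;> fin_cases j <;> simp [Pauli]

lemma conjTranspose_pairPauli (c : Fin 4 × Fin 4) : (pairPauli c)ᴴ = pairPauli c := by
  rw [pairPauli, conjTranspose_kronecker, conjTranspose_pauli, conjTranspose_pauli]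

lemma trace_pauli_mul (a b : Fin 4) :
    trace (Pauli a * Pauli b) = if a = b then 2 else 0 := by
  fin_cases a <;> fin_cases b <;> simp [Pauli, trace_fin_two] <;> norm_num

lemma coeff_pairPauli (c d : Fin 4 × Fin 4) : coeff c (pairPauli d) = if c = d then 1 else 0 := by
  rw [coeff, pairPauli, pairPauli, ← mul_kronecker_mul, trace_kronecker,
    trace_pauli_mul, trace_pauli_mul]
  simp only [Prod.ext_iff]
  split_ifs <;> first | (exfalso; tauto) | norm_num

lemma pairPauli_zero : pairPauli 0 = 1 := by
  simp [pairPauli, Pauli]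

/-- The sign by which two Pauli matrices commute. -/
def commSign (i j : Fin 4) : ℤ := if i = 0 ∨ j = 0 ∨ i = j then 1 else -1

lemma pauli_mul_pauli (i j : Fin 4) :
    Pauli i * Pauli j = (commSign i j : ℂ) • (Pauli j * Pauli i) := by
  ext x y
  fin_cases i <;> fin_cases j <;> fin_cases x <;> fin_cases y <;> simp [Pauli, commSign]

lemma pauli_mul_self (i : Fin 4) : Pauli i * Pauli i = 1 := by
  ext x y
  fin_cases i <;> fin_cases x <;> fin_cases y <;> simp [Pauli]

lemma pairPauli_mul_self (c : Fin 4 × Fin 4) : pairPauli c * pairPauli c = 1 := by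
  rw [pairPauli, ← mul_kronecker_mul, pauli_mul_self, pauli_mul_self, one_kronecker_one]

lemma pairPauli_anticomm {a b : Fin 4 × Fin 4}
    (h : commSign a.1 b.1 * commSign a.2 b.2 = -1) :
    pairPauli a * pairPauli b = -(pairPauli b * pairPauli a) := by
  have h' : (commSign a.1 b.1 : ℂ) * commSign a.2 b.2 = -1 := by exact_mod_cast h
  simp only [pairPauli]
  rw [← mul_kronecker_mul, ← mul_kronecker_mul, pauli_mul_pauli a.1, pauli_mul_pauli a.2,
    smul_kronecker, kronecker_smul, smul_smul, h', neg_one_smul]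

/-- Anticommuting Pauli matrices are conjugate. -/
lemma exists_conj_of_anticomm {a b : Fin 4 × Fin 4}
    (h : commSign a.1 b.1 * commSign a.2 b.2 = -1) :
    ∃ V : U4, (V : Gate2)ᴴ * pairPauli a * V = pairPauli b := by
  have hab := pairPauli_anticomm h
  have ha := pairPauli_mul_self a
  have hb := pairPauli_mul_self b
  set r : ℂ := ((Real.sqrt 2 : ℝ) : ℂ)⁻¹ with hr
  have hrr : r * r = 1 / 2 := by
    rw [hr, ← mul_inv, ← Complex.ofReal_mul, Real.mul_self_sqrt (by norm_num)]
    norm_num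
  have hstar : star r = r := by simp [hr]
  set V : Gate2 := r • (pairPauli a + pairPauli b) with hV
  have hVV : Vᴴ = V := by
    rw [hV, conjTranspose_smul, conjTranspose_add, conjTranspose_pairPauli,
      conjTranspose_pairPauli, hstar]
  have h1 : V * V = 1 := by
    rw [hV, smul_mul_smul_comm, hrr, add_mul, mul_add, mul_add, ha, hb, hab]
    ext i j
    simp
    ring
  refine ⟨⟨V, mem_unitaryGroup_iff.2 ?_⟩, ?_⟩
  · rw [star_eq_conjTranspose, hVV, h1]
  · change Vᴴ * pairPauli a * V = pairPauli b
    have h2 : pairPauli b * pairPauli a * pairPauli b = -pairPauli a := by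
      rw [mul_assoc, hab, mul_neg, ← mul_assoc, hb, one_mul]
    have h3 : (pairPauli a + pairPauli b) * pairPauli a * (pairPauli a + pairPauli b) =
        (2 : ℂ) • pairPauli b := by
      rw [add_mul, add_mul, mul_add, mul_add, ha, one_mul, one_mul, h2, mul_assoc, ha, mul_one,
        two_smul]
      abel
    rw [hVV, hV, smul_mul_assoc, smul_mul_smul_comm, hrr, h3, smul_smul]
    norm_num

/-- Any two nontrivial two-qubit Pauli matrices are conjugate. -/
lemma exists_conj {a b : Fin 4 × Fin 4} (ha : a ≠ 0) (hb : b ≠ 0) :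
    ∃ V : U4, (V : Gate2)ᴴ * pairPauli a * V = pairPauli b := by
  have key : ∀ a b : Fin 4 × Fin 4, a ≠ 0 → b ≠ 0 → ∃ c : Fin 4 × Fin 4,
      commSign a.1 c.1 * commSign a.2 c.2 = -1 ∧ commSign c.1 b.1 * commSign c.2 b.2 = -1 := by
    decide
  obtain ⟨c, hac, hcb⟩ := key a b ha hb
  obtain ⟨V, hV⟩ := exists_conj_of_anticomm hac
  obtain ⟨W, hW⟩ := exists_conj_of_anticomm hcb
  refine ⟨V * W, ?_⟩
  rw [← hW, ← hV]
  simp [conjTranspose_mul, mul_assoc]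

/-- The coefficient at `c` of the Heisenberg evolution of the Pauli `A` under `U`. -/
def gateCoeff (A c : Fin 4 × Fin 4) (U : U4) : ℂ :=
  coeff c ((U : Gate2)ᴴ * pairPauli A * U)

lemma gateCoeff_eq (A c : Fin 4 × Fin 4) (U : U4) :
    gateCoeff A c U = coeff A ((U : Gate2) * pairPauli c * (U : Gate2)ᴴ) := by
  rw [gateCoeff, coeff, coeff, trace_mul_comm (pairPauli c)]
  congr 1
  rw [mul_assoc, mul_assoc, trace_mul_comm]
  simp only [mul_assoc]

lemma conj_coeff {M : Gate2} (hM : Mᴴ = M) (A : Fin 4 × Fin 4) : star (coeff A M) = coeff A M := by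
  rw [coeff, star_mul', ← trace_conjTranspose, conjTranspose_mul, hM, conjTranspose_pairPauli,
    trace_mul_comm]
  simp

lemma sum_gateCoeff_mul_star (c d : Fin 4 × Fin 4) (U : U4) :
    ∑ A, gateCoeff A c U * star (gateCoeff A d U) = if c = d then 1 else 0 := by
  have hU : (U : Gate2)ᴴ * U = 1 := by
    rw [← star_eq_conjTranspose]; exact mem_unitaryGroup_iff'.1 U.2
  set X := (U : Gate2) * pairPauli c * (U : Gate2)ᴴ with hX
  set Y := (U : Gate2) * pairPauli d * (U : Gate2)ᴴ with hY
  have hYY : Yᴴ = Y := by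
    rw [hY]
    simp [conjTranspose_mul, conjTranspose_pairPauli, mul_assoc]
  have h1 : ∑ A, coeff A X * coeff A Y = 1 / 4 * trace (X * Y) := by
    conv_rhs => rw [← sum_coeff_smul X]
    simp only [sum_mul, trace_sum, smul_mul_assoc, trace_smul, smul_eq_mul, mul_sum]
    refine sum_congr rfl fun A _ => ?_
    rw [coeff, coeff]
    ring
  have h2 : trace (X * Y) = trace (pairPauli c * pairPauli d) := by
    calc trace (X * Y)
        = trace ((U : Gate2) *
            (pairPauli c * ((U : Gate2)ᴴ * (U : Gate2)) * pairPauli d * (U : Gate2)ᴴ)) := by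
          rw [hX, hY]; simp only [mul_assoc]
      _ = trace (pairPauli c * pairPauli d) := by
          rw [trace_mul_comm, hU, mul_one, mul_assoc, hU, mul_one]
  simp only [gateCoeff_eq, ← hX, ← hY, conj_coeff hYY]
  rw [h1, h2, ← coeff, coeff_pairPauli]

lemma gateCoeff_zero (c : Fin 4 × Fin 4) (U : U4) :
    gateCoeff 0 c U = if c = 0 then 1 else 0 := by
  have hU : (U : Gate2)ᴴ * U = 1 := by
    rw [← star_eq_conjTranspose]; exact mem_unitaryGroup_iff'.1 U.2
  rw [gateCoeff, pairPauli_zero, mul_one, hU, ← pairPauli_zero, coeff_pairPauli]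

instance : SecondCountableTopology Gate2 :=
  inferInstanceAs (SecondCountableTopology (Fin 2 × Fin 2 → Fin 2 × Fin 2 → ℂ))

instance : SecondCountableTopology U4 := TopologicalSpace.Subtype.secondCountableTopology _

instance : CompactSpace U4 := by
  refine isCompact_iff_compactSpace.1 ?_
  have hK : IsCompact {M : Gate2 | ∀ i ∈ Set.univ, M i ∈ {v : Fin 2 × Fin 2 → ℂ |
      ∀ j ∈ Set.univ, v j ∈ Metric.closedBall (0 : ℂ) 1}} :=
    isCompact_univ_pi fun _ => isCompact_univ_pi fun _ => isCompact_closedBall _ _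
  refine hK.of_isClosed_subset isClosed_unitary fun U hU i _ j _ => ?_
  rw [mem_closedBall_zero_iff]
  exact entry_norm_bound_of_unitary hU i j

lemma integrable_of_continuous {ι : Type*} [Fintype ι] (ν : Measure (ι → U4)) [IsFiniteMeasure ν]
    {f : (ι → U4) → ℂ} (hf : Continuous f) : Integrable f ν :=
  hf.integrable_of_hasCompactSupport (HasCompactSupport.of_compactSpace f)

lemma continuous_gateCoeff (A c : Fin 4 × Fin 4) : Continuous (gateCoeff A c) := by
  unfold gateCoeff coeff
  have h : Continuous fun U : U4 => (U : Gate2) := continuous_subtype_val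
  exact continuous_const.mul (continuous_const.matrix_mul
    ((h.matrix_conjTranspose.matrix_mul continuous_const).matrix_mul h)).matrix_trace

lemma integral_gateCoeff (μ : Measure U4) [μ.IsHaarMeasure] [IsProbabilityMeasure μ]
    (A c d : Fin 4 × Fin 4) :
    ∫ U, gateCoeff A c U * star (gateCoeff A d U) ∂μ =
      if c = d then (pairWeight A c : ℂ) else 0 := by
  by_cases hA : A = 0
  · subst hA
    simp only [gateCoeff_zero, pairWeight]
    by_cases hc : c = 0 <;> by_cases hd : d = 0 <;> by_cases hcd : c = d <;>
      simp_all
  · have hintegrable : ∀ B, Integrable (fun U => gateCoeff B c U * star (gateCoeff B d U)) μ := fun B =>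
      ((continuous_gateCoeff B c).mul (continuous_gateCoeff B d).star).integrable_of_hasCompactSupport
        (HasCompactSupport.of_compactSpace _)
    have hinv : ∀ B, B ≠ 0 → ∫ U, gateCoeff B c U * star (gateCoeff B d U) ∂μ =
        ∫ U, gateCoeff A c U * star (gateCoeff A d U) ∂μ := by
      intro B hB
      obtain ⟨V, hV⟩ := exists_conj hB hA
      rw [← integral_mul_left_eq_self _ V]
      have h : ∀ (e : Fin 4 × Fin 4) (U : U4), gateCoeff B e (V * U) = gateCoeff A e U := by
        intro e U
        rw [gateCoeff, gateCoeff, ← hV]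
        congr 1
        simp [conjTranspose_mul, mul_assoc]
      simp only [h]
    have hsum : ∑ B, ∫ U, gateCoeff B c U * star (gateCoeff B d U) ∂μ =
        if c = d then 1 else 0 := by
      rw [← integral_finsetSum _ fun B _ => hintegrable B]
      simp only [sum_gateCoeff_mul_star, integral_const, probReal_univ, one_smul]
    rw [← add_sum_erase univ _ (mem_univ (0 : Fin 4 × Fin 4)),
      sum_congr rfl fun B hB => hinv B (ne_of_mem_erase hB), sum_const,
      card_erase_of_mem (mem_univ _)] at hsum
    simp only [gateCoeff_zero, integral_const, probReal_univ, one_smul, card_univ,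
      Fintype.card_prod, Fintype.card_fin, nsmul_eq_mul] at hsum
    clear hintegrable hinv
    simp only [pairWeight, if_neg hA]
    generalize (∫ U, gateCoeff A c U * star (gateCoeff A d U) ∂μ) = J at hsum ⊢
    norm_num at hsum
    by_cases hc : c = 0 <;> by_cases hd : d = 0 <;> by_cases hcd : c = d <;>
      simp_all
    linear_combination hsum / 15

/-! ### Second moments of a layer -/

/-- The tensor product of the gates `g` at the positions of layer `t`. -/
def tensor (t : ℕ) (g : Fin m → Gate2) : Matrix (QIdx (2 * m)) (QIdx (2 * m)) ℂ :=
  of fun x y => ∏ j, g j (split t x j) (split t y j)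

lemma brickLayer_eq_tensor (t : ℕ) (g : Fin m → Gate2) : brickLayer t g = tensor t g := by
  ext x y
  unfold brickLayer tensor layerOdd layerEven
  simp only [split_apply, leftSite, rightSite]
  split_ifs <;> rfl

lemma pauliString_eq_tensor (t : ℕ) (α : Fin (2 * m) → Fin 4) :
    pauliString α = tensor t fun j => pairPauli (split t α j) := by
  ext x y
  simp only [pauliString, tensor, of_apply]
  rw [prod_site t]
  rfl

lemma tensor_mul (t : ℕ) (g h : Fin m → Gate2) :
    tensor t g * tensor t h = tensor t fun j => g j * h j := by
  ext x y
  simp only [mul_apply, tensor, of_apply, ← prod_mul_distrib]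
  rw [← sum_prod_eq_prod_sum fun j v => g j (split t x j) v * h j v (split t y j)]
  exact Equiv.sum_comp (split t) fun v : Fin m → Fin 2 × Fin 2 =>
    ∏ j, g j (split t x j) (v j) * h j (v j) (split t y j)

lemma conjTranspose_tensor (t : ℕ) (g : Fin m → Gate2) :
    (tensor t g)ᴴ = tensor t fun j => (g j)ᴴ := by
  ext x y
  simp [tensor, conjTranspose_apply]

lemma tensor_eq_sum (t : ℕ) (g : Fin m → Gate2) :
    tensor t g = ∑ β : Fin m → Fin 4 × Fin 4,
      (∏ j, coeff (β j) (g j)) • pauliString ((split t).symm β) := by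
  ext x y
  simp only [Matrix.sum_apply, Matrix.smul_apply, smul_eq_mul, pauliString_eq_tensor t,
    Equiv.apply_symm_apply]
  simp only [tensor, of_apply, ← prod_mul_distrib]
  rw [sum_prod_eq_prod_sum fun j c => coeff c (g j) * pairPauli c (split t x j) (split t y j)]
  refine prod_congr rfl fun j _ => ?_
  conv_lhs => rw [← sum_coeff_smul (g j)]
  simp only [Matrix.sum_apply, Matrix.smul_apply, smul_eq_mul]

/-- The expectation of `σ_α` in the state prepared by the circuit with gates `ω`. -/
def pauliExp (d : ℕ) (α : Fin (2 * m) → Fin 4) (ω : Fin d × Fin m → U4) : ℂ :=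
  zeroExp (circuitOf (gatesOf ω)) (pauliString α)

lemma circuitOf_succ {d : ℕ} (G : GateAssign m (d + 1)) :
    circuitOf G = brickLayer d (G (Fin.last d)) * circuitOf fun t => G t.castSucc := by
  simp [circuitOf, List.finRange_succ_last, List.foldl_map]

/-- The Heisenberg evolution of a Pauli string through the last layer. -/
lemma pauliExp_succ (d : ℕ) (α : Fin (2 * m) → Fin 4) (ω : Fin (d + 1) × Fin m → U4) :
    pauliExp (d + 1) α ω = ∑ β : Fin m → Fin 4 × Fin 4,
      pauliExp d ((split d).symm β) (fun p => ω (p.1.castSucc, p.2)) *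
        ∏ j, gateCoeff (split d α j) (β j) (ω (Fin.last d, j)) := by
  have h : ∀ (L C A : Matrix (QIdx (2 * m)) (QIdx (2 * m)) ℂ),
      zeroExp (L * C) A = zeroExp C (Lᴴ * A * L) := by
    intro L C A
    simp only [zeroExp, conjTranspose_mul, mul_assoc]
  unfold pauliExp
  rw [circuitOf_succ, h, brickLayer_eq_tensor, pauliString_eq_tensor d α, conjTranspose_tensor,
    tensor_mul, tensor_mul, tensor_eq_sum]
  simp only [zeroExp, Matrix.mul_sum, Matrix.sum_mul, Matrix.mul_smul, Matrix.smul_mul,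
    Matrix.sum_apply, Matrix.smul_apply, smul_eq_mul]
  refine sum_congr rfl fun β _ => ?_
  rw [mul_comm]
  rfl

lemma continuous_pauliExp (d : ℕ) (α : Fin (2 * m) → Fin 4) : Continuous (pauliExp d α) := by
  induction d generalizing α with
  | zero => exact continuous_of_discreteTopology
  | succ d ih =>
    simp only [funext (pauliExp_succ d α)]
    refine continuous_finsetSum _ fun β _ => ?_
    have h : Continuous fun (x : Fin (d + 1) × Fin m → U4) (p : Fin d × Fin m) =>
        x (p.1.castSucc, p.2) := continuous_pi fun p => continuous_apply _
    refine ((ih _).comp h).mul ?_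
    exact continuous_finsetProd _ fun j _ => (continuous_gateCoeff _ _).comp (continuous_apply _)

/-- The gate positions of `d + 1` layers. -/
def positionEquiv (d m : ℕ) : (Fin d × Fin m) ⊕ Fin m ≃ Fin (d + 1) × Fin m :=
  Equiv.ofBijective (Sum.elim (fun p => (p.1.castSucc, p.2)) fun j => (Fin.last d, j)) <| by
    refine (Fintype.bijective_iff_injective_and_card _).2 ⟨?_, by simp [add_mul]⟩
    rintro (⟨i, j⟩ | j) (⟨i', j'⟩ | j') h <;>
      simp_all [Prod.ext_iff, Fin.ext_iff] <;> omega

lemma integral_position_succ (μ : Measure U4) [IsProbabilityMeasure μ] (d : ℕ)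
    (f : (Fin (d + 1) × Fin m → U4) → ℂ) (g : (Fin d × Fin m → U4) → (Fin m → U4) → ℂ)
    (hfg : ∀ ω, f ω = g (fun p => ω (p.1.castSucc, p.2)) fun j => ω (Fin.last d, j)) :
    ∫ ω, f ω ∂(Measure.pi fun _ => μ) =
      ∫ p : (Fin d × Fin m → U4) × (Fin m → U4), g p.1 p.2
        ∂((Measure.pi fun _ => μ).prod (Measure.pi fun _ => μ)) := by
  have h₁ := measurePreserving_piCongrLeft (α := fun _ : Fin (d + 1) × Fin m => U4)
    (fun _ => μ) (positionEquiv d m)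
  have h₂ := measurePreserving_sumPiEquivProdPi (X := fun _ : (Fin d × Fin m) ⊕ Fin m => U4)
    fun _ => μ
  rw [← h₁.integral_comp' f, ← h₂.integral_comp' fun p => g p.1 p.2]
  refine integral_congr_ae (Filter.Eventually.of_forall fun x => ?_)
  have hx := MeasurableEquiv.piCongrLeft_apply_apply (positionEquiv d m)
    (β := fun _ => U4) x
  simp only [hfg]
  congr 1
  · funext p
    exact hx (Sum.inl p)
  · funext j
    exact hx (Sum.inr j)

lemma ofReal_collision (μ : Measure U4) [μ.IsHaarMeasure] [IsProbabilityMeasure μ] (d : ℕ)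
    (α : Fin (2 * m) → Fin 4) :
    ∫ ω, pauliExp d α ω * star (pauliExp d α ω) ∂(Measure.pi fun _ => μ) =
      (collision m d α : ℂ) := by
  induction d generalizing α with
  | zero =>
    have h : ∀ ω : Fin 0 × Fin m → U4, pauliExp 0 α ω * star (pauliExp 0 α ω) =
        (collision m 0 α : ℂ) := by
      intro ω
      simp only [pauliExp, zeroExp, circuitOf, List.finRange_zero, List.foldl_nil,
        conjTranspose_one, one_mul, mul_one, pauliString, of_apply, allZero, star_prod, collision,
        Complex.ofReal_prod, ← prod_mul_distrib]
      refine prod_congr rfl fun i _ => ?_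
      generalize α i = b
      fin_cases b <;> simp [Pauli, zeroWeight]
    simp only [h, integral_const, probReal_univ, one_smul]
  | succ d ih =>
    set r : (Fin m → Fin 4 × Fin 4) → (Fin m → U4) → ℂ := fun β ω =>
      ∏ j, gateCoeff (split d α j) (β j) (ω j) with hr
    have hrc : ∀ β, Continuous (r β) := fun β =>
      continuous_finsetProd _ fun j _ => (continuous_gateCoeff _ _).comp (continuous_apply _)
    set z : (Fin m → Fin 4 × Fin 4) → (Fin d × Fin m → U4) → ℂ := fun β =>
      pauliExp d ((split d).symm β) with hz
    have hzc : ∀ β, Continuous (z β) := fun β => continuous_pauliExp d _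
    rw [integral_position_succ μ d _ (fun ω₁ ω₂ => ∑ β, ∑ γ,
      (z β ω₁ * star (z γ ω₁)) * (r β ω₂ * star (r γ ω₂)))]
    · have hintegrable : ∀ β γ, Integrable (fun p : (Fin d × Fin m → U4) × (Fin m → U4) =>
          (z β p.1 * star (z γ p.1)) * (r β p.2 * star (r γ p.2)))
          ((Measure.pi fun _ => μ).prod (Measure.pi fun _ => μ)) := fun β γ =>
        (integrable_of_continuous _ ((hzc β).mul (hzc γ).star)).mul_prod
          (integrable_of_continuous _ ((hrc β).mul (hrc γ).star))
      rw [integral_finsetSum _ fun β _ => integrable_finsetSum _ fun γ _ => hintegrable β γ]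
      simp only [integral_finsetSum _ fun γ _ => hintegrable _ γ]
      have hrr : ∀ β γ, ∫ ω, r β ω * star (r γ ω) ∂(Measure.pi fun _ => μ) =
          if β = γ then ((∏ j, pairWeight (split d α j) (β j) : ℝ) : ℂ) else 0 := by
        intro β γ
        simp only [hr, star_prod, ← prod_mul_distrib]
        rw [integral_fintype_prod_eq_prod fun j U =>
          gateCoeff (split d α j) (β j) U * star (gateCoeff (split d α j) (γ j) U)]
        simp only [integral_gateCoeff]
        split_ifs with h
        · simp [h]
        · obtain ⟨j, hj⟩ := Function.ne_iff.1 h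
          exact prod_eq_zero (mem_univ j) (if_neg hj)
      have hterm : ∀ β γ, ∫ p : (Fin d × Fin m → U4) × (Fin m → U4),
          (z β p.1 * star (z γ p.1)) * (r β p.2 * star (r γ p.2))
            ∂((Measure.pi fun _ => μ).prod (Measure.pi fun _ => μ)) =
          (∫ ω, z β ω * star (z γ ω) ∂(Measure.pi fun _ => μ)) *
            if β = γ then ((∏ j, pairWeight (split d α j) (β j) : ℝ) : ℂ) else 0 := by
        intro β γ
        rw [integral_prod_mul (fun ω => z β ω * star (z γ ω)) fun ω => r β ω * star (r γ ω), hrr]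
      simp only [hterm, mul_ite, mul_zero, sum_ite_eq, mem_univ, if_true]
      simp only [hz, ih, collision]
      push_cast
      exact sum_congr rfl fun β _ => mul_comm _ _
    · intro ω
      simp only [pauliExp_succ, star_sum, sum_mul_sum]
      refine sum_congr rfl fun β _ => sum_congr rfl fun γ _ => ?_
      simp only [hz, hr, star_mul']
      ring

end Scrambling

end

noncomputable section

/-- **Fast scrambling of 3-local errors.**
There exist universal constants `Δ > 0` and `C₀ > 0` such that for every even `n = 2m ≥ 2`,
every depth `l ≥ 1`, and every nonidentity `n`-qubit Pauli string `σ_α` acting nontrivially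
on at most 3 consecutive qubits of the ring (all qubits where it differs from the identity
lie in `{j, j+1, j+2}` mod `n` for some `j`),
`E_{C∼RQC(n,l)} |⟨0^n| C† σ_α C |0^n⟩|² ≤ C₀ · e^{−Δ l} + 1/(2^n + 1)`. -/
theorem fast_scrambling_three_local_errors :
    ∃ Δ C₀ : ℝ, 0 < Δ ∧ 0 < C₀ ∧
      ∀ (m l : ℕ) (hm : 1 ≤ m) (hl : 1 ≤ l)
        (α : Fin (2 * m) → Fin 4) (hα : α ≠ fun _ => 0)
        (hloc : ∃ j : Fin (2 * m), ∀ i, α i ≠ 0 → (i - j).1 < 3)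
        (μ : Measure U4) [μ.IsHaarMeasure] [IsProbabilityMeasure μ],
        (∫ ω : Fin l × Fin m → U4,
            Complex.normSq (zeroExp (circuitOf (gatesOf ω)) (pauliString α))
            ∂(Measure.pi fun _ => μ))
          ≤ C₀ * Real.exp (-Δ * l) + 1 / (2 ^ (2 * m) + 1) := by
  refine ⟨Real.log (144 / 125), 36 / 25, Real.log_pos (by norm_num), by norm_num, ?_⟩
  intro m l _ hl α hα _ μ _ _
  obtain ⟨d, rfl⟩ : ∃ d, l = d + 1 := ⟨l - 1, by omega⟩
  have hcol : (∫ ω : Fin (d + 1) × Fin m → U4,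
      Complex.normSq (zeroExp (circuitOf (gatesOf ω)) (pauliString α))
        ∂(Measure.pi fun _ => μ)) = Scrambling.collision m (d + 1) α := by
    rw [← Complex.ofReal_inj, ← Scrambling.ofReal_collision μ, ← integral_complex_ofReal]
    refine integral_congr_ae (Filter.Eventually.of_forall fun ω => ?_)
    exact (Complex.mul_conj _).symm
  have hexp : Real.exp (-Real.log (144 / 125) * (d + 1 : ℕ)) = (125 / 144) ^ (d + 1) := by
    rw [← Real.log_inv, mul_comm, Real.exp_nat_mul, Real.exp_log (by norm_num)]
    norm_num
  rw [hcol, hexp]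
  refine (Scrambling.collision_succ_le d hα).trans (le_of_eq ?_)
  rw [pow_mul]
  have h : ((125 : ℝ) / 144) ^ d = (25 / 36) ^ d * (5 / 4) ^ d := by
    rw [← mul_pow]
    norm_num
  rw [pow_succ, pow_succ, h]
  norm_num
  ring

end
end

section
/- Exact value of the scrambling quantity at depth one: for every even n ≥ 2, E_{C∼RQC(n,1)} |⟨0^n| C† X₁ C |0^n⟩|² = 1/5, where X₁ is the Pauli X matrix acting on the first qubit; that is, all gates not overlapping the error cancel, and the expectation reduces to E_{U∼U(4)} |⟨00| U† (X⊗I) U |00⟩|² = 1/5 for a single Haar-random two-qubit gate. -/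
open MeasureTheory Matrix

noncomputable section

open Kronecker

/-- The two-qubit Pauli matrix `Pauli a ⊗ Pauli b`. -/
def pauliPair (a b : Fin 4) : Gate2 := Pauli a ⊗ₖ Pauli b

/-- `|⟨00| U† A U |00⟩|²`. -/
def gateExpSq (A : Gate2) (U : U4) : ℝ :=
  Complex.normSq (((U : Gate2)ᴴ * A * (U : Gate2)) (0, 0) (0, 0))

lemma pauli_conjTranspose (a : Fin 4) : (Pauli a)ᴴ = Pauli a := by
  fin_cases a <;> ext i j <;> fin_cases i <;> fin_cases j <;>
    simp [Pauli, Matrix.conjTranspose_apply]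

lemma pauli_mul_self (a : Fin 4) : Pauli a * Pauli a = 1 := by
  fin_cases a <;> ext i j <;> fin_cases i <;> fin_cases j <;>
    simp [Pauli, Matrix.mul_apply]

lemma pauli_anticomm {a b : Fin 4} (ha : a ≠ 0) (hb : b ≠ 0) (hab : a ≠ b) :
    Pauli a * Pauli b = -(Pauli b * Pauli a) := by
  fin_cases a <;> fin_cases b <;> first
    | exact absurd rfl ha
    | exact absurd rfl hb
    | exact absurd rfl hab
    | ext i j; fin_cases i <;> fin_cases j <;> simp [Pauli, Matrix.mul_apply]

lemma pauli_zero : Pauli 0 = 1 := rfl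

lemma pauliPair_conjTranspose (a b : Fin 4) : (pauliPair a b)ᴴ = pauliPair a b := by
  simp [pauliPair, Matrix.conjTranspose_kronecker, pauli_conjTranspose]

lemma pauliPair_mul_self (a b : Fin 4) : pauliPair a b * pauliPair a b = 1 := by
  simp [pauliPair, ← Matrix.mul_kronecker_mul, pauli_mul_self]

lemma pauliPair_anticomm_left {a b c d : Fin 4} (ha : a ≠ 0) (hc : c ≠ 0) (hac : a ≠ c)
    (hbd : Pauli b * Pauli d = Pauli d * Pauli b) :
    pauliPair a b * pauliPair c d = -(pauliPair c d * pauliPair a b) := by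
  rw [pauliPair, pauliPair, ← Matrix.mul_kronecker_mul, ← Matrix.mul_kronecker_mul,
    pauli_anticomm ha hc hac, hbd]
  ext ⟨i, i'⟩ ⟨j, j'⟩
  simp [Matrix.kroneckerMap_apply]

lemma pauliPair_anticomm_right {a b c d : Fin 4} (hb : b ≠ 0) (hd : d ≠ 0) (hbd : b ≠ d)
    (hac : Pauli a * Pauli c = Pauli c * Pauli a) :
    pauliPair a b * pauliPair c d = -(pauliPair c d * pauliPair a b) := by
  rw [pauliPair, pauliPair, ← Matrix.mul_kronecker_mul, ← Matrix.mul_kronecker_mul,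
    pauli_anticomm hb hd hbd, hac]
  ext ⟨i, i'⟩ ⟨j, j'⟩
  simp [Matrix.kroneckerMap_apply]

lemma integral_gateExpSq_eq_of_anticomm (μ : Measure U4) [μ.IsMulLeftInvariant] {A B : Gate2}
    (hA : Aᴴ = A) (hB : Bᴴ = B) (hA2 : A * A = 1) (hB2 : B * B = 1) (h : A * B = -(B * A)) :
    ∫ U, gateExpSq A U ∂μ = ∫ U, gateExpSq B U ∂μ := by
  set r : ℂ := Complex.ofReal (Real.sqrt 2)⁻¹ with hr
  have hr2 : r * r = 1 / 2 := by
    rw [hr, ← Complex.ofReal_mul, ← mul_inv, Real.mul_self_sqrt zero_le_two]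
    norm_num
  have hrs : star r = r := Complex.conj_ofReal _
  set V : Gate2 := r • (A + B) with hV
  have hVs : star V = V := by
    rw [hV, star_smul, hrs, star_add, Matrix.star_eq_conjTranspose,
      Matrix.star_eq_conjTranspose, hA, hB]
  have hVV : V * V = 1 := by
    have : (A + B) * (A + B) = (2 : ℂ) • (1 : Gate2) := by
      rw [mul_add, add_mul, add_mul, hA2, hB2, h, two_smul]; abel
    rw [hV, smul_mul_smul_comm, this, hr2, smul_smul]; norm_num
  have hVA : V * A = B * V := by
    rw [hV, smul_mul_assoc, mul_smul_comm, add_mul, mul_add, hA2, hB2, add_comm]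
  have hconj : V * A * V = B := by rw [hVA, mul_assoc, hVV, mul_one]
  let W : U4 := ⟨V, by rw [Matrix.mem_unitaryGroup_iff, hVs, hVV]⟩
  rw [← integral_mul_left_eq_self (fun U => gateExpSq A U) W]
  congr 1 with U
  have : ((W * U : U4) : Gate2) = V * U := rfl
  rw [gateExpSq, gateExpSq, this, Matrix.conjTranspose_mul, ← Matrix.star_eq_conjTranspose V, hVs,
    ← hconj]
  simp only [mul_assoc]

lemma integral_gateExpSq_pauliPair (μ : Measure U4) [μ.IsMulLeftInvariant] {a b : Fin 4}
    (hab : a ≠ 0 ∨ b ≠ 0) :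
    ∫ U, gateExpSq (pauliPair a b) U ∂μ = ∫ U, gateExpSq (pauliPair 1 0) U ∂μ := by
  have left : ∀ {a b c d : Fin 4}, a ≠ 0 → c ≠ 0 → a ≠ c → (b = 0 ∨ d = 0) →
      ∫ U, gateExpSq (pauliPair a b) U ∂μ = ∫ U, gateExpSq (pauliPair c d) U ∂μ := by
    intro a b c d ha hc hac h
    refine integral_gateExpSq_eq_of_anticomm μ (pauliPair_conjTranspose _ _)
      (pauliPair_conjTranspose _ _) (pauliPair_mul_self _ _) (pauliPair_mul_self _ _)
      (pauliPair_anticomm_left ha hc hac ?_)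
    rcases h with rfl | rfl <;> simp [pauli_zero]
  by_cases ha : a = 0
  · subst ha
    have hb : b ≠ 0 := by simpa using hab
    obtain ⟨d, hd, hbd⟩ : ∃ d : Fin 4, d ≠ 0 ∧ b ≠ d := by revert b; decide
    trans ∫ U, gateExpSq (pauliPair 3 d) U ∂μ
    · exact integral_gateExpSq_eq_of_anticomm μ (pauliPair_conjTranspose _ _)
        (pauliPair_conjTranspose _ _) (pauliPair_mul_self _ _) (pauliPair_mul_self _ _)
        (pauliPair_anticomm_right hb hd hbd (by simp [pauli_zero]))
    · exact left (by decide) (by decide) (by decide) (Or.inr rfl)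
  · by_cases ha1 : a = 1
    · subst ha1
      trans ∫ U, gateExpSq (pauliPair 3 0) U ∂μ <;>
        exact left (by decide) (by decide) (by decide) (by simp)
    · exact left ha (by decide) ha1 (Or.inr rfl)

lemma sum_normSq_unitary_column (U : U4) :
    ∑ i, Complex.normSq ((U : Gate2) i (0, 0)) = 1 := by
  have h := congrFun (congrFun (Matrix.mem_unitaryGroup_iff'.mp U.2) (0, 0)) (0, 0)
  rw [Matrix.mul_apply, Matrix.one_apply_eq] at h
  rw [← Complex.ofReal_inj, Complex.ofReal_sum, Complex.ofReal_one, ← h]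
  refine Finset.sum_congr rfl fun i _ => ?_
  rw [Complex.normSq_eq_conj_mul_self]
  rfl

/-- Purity of a pure state, expanded in the Pauli basis. -/
lemma sum_gateExpSq_pauliPair (U : U4) :
    ∑ a, ∑ b, gateExpSq (pauliPair a b) U = 4 := by
  have h := sum_normSq_unitary_column U
  have key : ∑ a, ∑ b, gateExpSq (pauliPair a b) U
      = 4 * (∑ i, Complex.normSq ((U : Gate2) i (0, 0))) ^ 2 := by
    simp only [gateExpSq, Matrix.mul_apply, Fintype.sum_prod_type, Fin.sum_univ_four,
      Fin.sum_univ_two, Matrix.conjTranspose_apply, pauliPair, Matrix.kroneckerMap_apply]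
    generalize (U : Gate2) (0, 0) (0, 0) = p
    generalize (U : Gate2) (0, 1) (0, 0) = q
    generalize (U : Gate2) (1, 0) (0, 0) = s
    generalize (U : Gate2) (1, 1) (0, 0) = t
    simp [Pauli, Complex.normSq_apply]
    ring
  rw [key, h]; norm_num

lemma gateExpSq_pauliPair_zero (U : U4) : gateExpSq (pauliPair 0 0) U = 1 := by
  have h := Matrix.mem_unitaryGroup_iff'.mp U.2
  rw [Matrix.star_eq_conjTranspose] at h
  simp [gateExpSq, pauliPair, pauli_zero, h]

lemma gateExpSq_pauliPair_le (a b : Fin 4) (U : U4) : gateExpSq (pauliPair a b) U ≤ 4 := by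
  have hnn : ∀ a b, 0 ≤ gateExpSq (pauliPair a b) U := fun _ _ => Complex.normSq_nonneg _
  rw [← sum_gateExpSq_pauliPair U]
  exact (Finset.single_le_sum (f := fun b => gateExpSq (pauliPair a b) U)
      (fun b _ => hnn a b) (Finset.mem_univ b)).trans
    (Finset.single_le_sum (f := fun a => ∑ b, gateExpSq (pauliPair a b) U)
      (fun a _ => Finset.sum_nonneg fun b _ => hnn a b) (Finset.mem_univ a))

lemma continuous_gateExpSq (A : Gate2) : Continuous (gateExpSq A) := by
  have h : Continuous fun U : U4 => (U : Gate2)ᴴ * A * (U : Gate2) := by fun_prop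
  exact Complex.continuous_normSq.comp (h.matrix_elem _ _)

lemma integrable_gateExpSq_pauliPair (μ : Measure U4) [IsFiniteMeasure μ] (a b : Fin 4) :
    Integrable (gateExpSq (pauliPair a b)) μ := by
  refine Integrable.of_bound (continuous_gateExpSq _).measurable.aestronglyMeasurable 4
    (Filter.Eventually.of_forall fun U => ?_)
  rw [gateExpSq, Real.norm_of_nonneg (Complex.normSq_nonneg _)]
  exact gateExpSq_pauliPair_le a b U

lemma integral_gateExpSq_pauliX (μ : Measure U4) [μ.IsMulLeftInvariant] [IsProbabilityMeasure μ] :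
    ∫ U, gateExpSq (pauliPair 1 0) U ∂μ = 1 / 5 := by
  have h : ∑ a, ∑ b, ∫ U, gateExpSq (pauliPair a b) U ∂μ = 4 := by
    have hi : ∀ a b, Integrable (gateExpSq (pauliPair a b)) μ := integrable_gateExpSq_pauliPair μ
    calc _ = ∑ a, ∫ U, ∑ b, gateExpSq (pauliPair a b) U ∂μ :=
          Finset.sum_congr rfl fun a _ => (integral_finsetSum _ fun b _ => hi a b).symm
      _ = ∫ U, ∑ a, ∑ b, gateExpSq (pauliPair a b) U ∂μ :=
          (integral_finsetSum _ fun a _ => integrable_finsetSum _ fun b _ => hi a b).symm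
      _ = 4 := by simp [sum_gateExpSq_pauliPair]
  have h0 : ∫ U, gateExpSq (pauliPair 0 0) U ∂μ = 1 := by simp [gateExpSq_pauliPair_zero]
  set c := ∫ U, gateExpSq (pauliPair 1 0) U ∂μ with hc
  have hval : ∀ a b : Fin 4, ∫ U, gateExpSq (pauliPair a b) U ∂μ
      = if a = 0 ∧ b = 0 then 1 else c := by
    intro a b
    split_ifs with hab
    · rw [hab.1, hab.2, h0]
    · exact integral_gateExpSq_pauliPair μ (by tauto)
  have h2 : (2 : Fin 4) ≠ 0 := by decide
  have h3 : (3 : Fin 4) ≠ 0 := by decide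
  norm_num [hval, Fin.sum_univ_four, h2, h3] at h
  linarith

/-- Grouping the qubits of a ring of even length into consecutive pairs. -/
def pairQubits (m : ℕ) : QIdx (2 * m) ≃ (Fin m → Fin 2 × Fin 2) where
  toFun x j := (x ⟨2 * j.1, by have := j.2; omega⟩, x ⟨2 * j.1 + 1, by have := j.2; omega⟩)
  invFun y k := if k.1 % 2 = 0 then (y ⟨k.1 / 2, by have := k.2; omega⟩).1
    else (y ⟨k.1 / 2, by have := k.2; omega⟩).2
  left_inv x := by
    funext k
    dsimp only
    split_ifs with h <;> congr 2 <;> omega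
  right_inv y := by
    funext j
    have h : (2 * j.1 + 1) / 2 = j.1 := by omega
    ext <;> simp [h, Nat.add_mod]

/-- Tensor product of two-qubit operators acting on the consecutive pairs of qubits. -/
def tensorPairs {m : ℕ} (g : Fin m → Gate2) : Matrix (QIdx (2 * m)) (QIdx (2 * m)) ℂ :=
  Matrix.of fun x y => ∏ j, g j (pairQubits m x j) (pairQubits m y j)

lemma tensorPairs_mul {m : ℕ} (g h : Fin m → Gate2) :
    tensorPairs g * tensorPairs h = tensorPairs (fun j => g j * h j) := by
  ext x y
  simp only [tensorPairs, Matrix.mul_apply, Matrix.of_apply, ← Finset.prod_mul_distrib]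
  rw [Fintype.prod_sum, ← (pairQubits m).sum_comp]

lemma tensorPairs_conjTranspose {m : ℕ} (g : Fin m → Gate2) :
    (tensorPairs g)ᴴ = tensorPairs (fun j => (g j)ᴴ) := by
  ext x y
  simp [tensorPairs, Matrix.conjTranspose_apply]

lemma prod_fin_two_mul {m : ℕ} (f : Fin (2 * m) → ℂ) :
    ∏ i, f i = ∏ j : Fin m, f ⟨2 * j.1, by have := j.2; omega⟩
      * f ⟨2 * j.1 + 1, by have := j.2; omega⟩ := by
  rw [← ((finProdFinEquiv (m := m) (n := 2)).trans (finCongr (mul_comm m 2))).prod_comp,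
    Fintype.prod_prod_type]
  refine Finset.prod_congr rfl fun j _ => ?_
  rw [Fin.prod_univ_two]
  congr 2 <;> ext <;> simp [finProdFinEquiv, add_comm]

lemma pauliXat_zero_eq_tensorPairs {m : ℕ} (hm : 0 < m) :
    pauliXat (⟨0, by omega⟩ : Fin (2 * m))
      = tensorPairs fun j => if j = ⟨0, hm⟩ then pauliPair 1 0 else 1 := by
  ext x y
  simp only [pauliXat, pauliString, tensorPairs, Matrix.of_apply]
  rw [prod_fin_two_mul]
  refine Finset.prod_congr rfl fun j _ => ?_
  by_cases hj : j.1 = 0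
  · simp [Fin.ext_iff, hj, pauliPair, pairQubits, Matrix.kroneckerMap_apply]
  · simp [Fin.ext_iff, hj, pairQubits, Pauli, Matrix.one_apply, Prod.ext_iff, ite_and]
    split_ifs <;> rfl

lemma normSq_zeroExp_depth_one {m : ℕ} (hm : 0 < m) (ω : Fin 1 × Fin m → U4) :
    Complex.normSq (zeroExp (circuitOf (gatesOf ω)) (pauliXat ⟨0, by omega⟩))
      = gateExpSq (pauliPair 1 0) (ω (0, ⟨0, hm⟩)) := by
  have hC : circuitOf (gatesOf ω) = tensorPairs fun j => (ω (0, j) : Gate2) := by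
    simp [circuitOf, brickLayer, layerOdd, gatesOf, tensorPairs, pairQubits, List.finRange_succ]
  rw [hC, pauliXat_zero_eq_tensorPairs hm, zeroExp, tensorPairs_conjTranspose, tensorPairs_mul,
    tensorPairs_mul, gateExpSq]
  congr 1
  simp only [tensorPairs, Matrix.of_apply]
  rw [Finset.prod_eq_single ⟨0, hm⟩]
  · simp [pairQubits, allZero]
  · intro j _ hj
    have h := Matrix.mem_unitaryGroup_iff'.mp (ω (0, j)).2
    rw [Matrix.star_eq_conjTranspose] at h
    simp [hj, h, pairQubits, allZero]
  · simp

/-- **Exact value of the scrambling quantity at depth one.**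
For every even `n = 2m ≥ 2`, `E_{C∼RQC(n,1)} |⟨0^n| C† X₁ C |0^n⟩|² = 1/5`;
equivalently, all gates not overlapping the error cancel and the expectation reduces to a
single Haar-random two-qubit gate: `E_{U∼U(4)} |⟨00| U† (X⊗I) U |00⟩|² = 1/5`. -/
theorem depth_one_scrambling_value
    (m : ℕ) (hm : 1 ≤ m)
    (μ : Measure U4) [μ.IsHaarMeasure] [IsProbabilityMeasure μ] :
    (∫ ω : Fin 1 × Fin m → U4,
        Complex.normSq (zeroExp (circuitOf (gatesOf ω)) (pauliXat ⟨0, by omega⟩))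
        ∂(Measure.pi fun _ => μ)) = 1 / 5
    ∧ (∫ U : U4,
        Complex.normSq
          (((U : Gate2)ᴴ * (Pauli 1 ⊗ₖ (1 : Matrix (Fin 2) (Fin 2) ℂ)) * (U : Gate2))
            (0, 0) (0, 0)) ∂μ) = 1 / 5 := by
  have hX : pauliPair 1 0 = Pauli 1 ⊗ₖ (1 : Matrix (Fin 2) (Fin 2) ℂ) := rfl
  have hU := integral_gateExpSq_pauliX μ
  refine ⟨?_, by simpa only [gateExpSq, hX] using hU⟩
  simp only [normSq_zeroExp_depth_one hm]
  rw [← hU]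
  have hp := measurePreserving_eval (fun _ : Fin 1 × Fin m => μ) (0, ⟨0, hm⟩)
  have h := integral_map hp.aemeasurable
    (continuous_gateExpSq (pauliPair 1 0)).measurable.aestronglyMeasurable
  rw [hp.map_eq] at h
  exact h.symm

end
end
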